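/- arXiv:1709.06965 — 2 statements merged into one kernel-verified Lean document; each statement's English description precedes it below -/
import Mathlib

section
/- For all integers p, q with 1 ≤ p ≤ q and p + q ≥ 3, the spherical cover number σ²₃(K_{p,q}) of the complete bipartite graph K_{p,q} satisfies ⌈pq/(2p + 2q − 4)⌉ ≤ σ²₃(K_{p,q}) ≤ p. Moreover, if additionally q > p(p − 1), then σ²₃(K_{p,q}) = ⌈p/2⌉. -/
open Set

noncomputable section

/-- An `l`-dimensional sphere in `ℝ^d`: the set of points of an `(l+1)`-dimensional affine
subspace `P` of `ℝ^d` at a fixed positive distance `r` from a center `c ∈ P`. -/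
def IsSphereDim (d l : ℕ) (S : Set (EuclideanSpace ℝ (Fin d))) : Prop :=
  ∃ (P : AffineSubspace ℝ (EuclideanSpace ℝ (Fin d))) (c : EuclideanSpace ℝ (Fin d)) (r : ℝ),
    Module.finrank ℝ P.direction = l + 1 ∧ c ∈ P ∧ 0 < r ∧
    S = {x | x ∈ P ∧ dist x c = r}

/-- A circle in `ℝ^d` is a 1-dimensional sphere. -/
def IsCircle (d : ℕ) (S : Set (EuclideanSpace ℝ (Fin d))) : Prop :=
  IsSphereDim d 1 S

/-- An arc in `ℝ^d`: a nonempty compact connected subset of a circle. -/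
def IsArc (d : ℕ) (A : Set (EuclideanSpace ℝ (Fin d))) : Prop :=
  ∃ C, IsCircle d C ∧ A ⊆ C ∧ IsCompact A ∧ IsConnected A

/-- A crossing-free circular-arc drawing of a simple graph `G` in `ℝ^d`:
vertices are mapped injectively to points, every edge `e = uv` is represented by an arc
`arc e` containing the images of `u` and `v`, the arcs of two distinct edges intersect
exactly in the images of the common endpoints of those edges, and the image of a vertex `w`
lies on the arc of an edge `e` only if `w` is an endpoint of `e`. -/
structure CircularArcDrawing (d : ℕ) {V : Type*} (G : SimpleGraph V) where
  pos : V → EuclideanSpace ℝ (Fin d)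
  inj : Function.Injective pos
  arc : Sym2 V → Set (EuclideanSpace ℝ (Fin d))
  arc_isArc : ∀ e ∈ G.edgeSet, IsArc d (arc e)
  endpoint_mem : ∀ e ∈ G.edgeSet, ∀ v ∈ e, pos v ∈ arc e
  crossFree : ∀ e ∈ G.edgeSet, ∀ f ∈ G.edgeSet, e ≠ f →
    arc e ∩ arc f = pos '' {w | w ∈ e ∧ w ∈ f}
  vertex_mem : ∀ e ∈ G.edgeSet, ∀ w, pos w ∈ arc e → w ∈ e

/-- The drawing `D` is covered by the family `𝒞` of sets:
every arc of `D` is contained in some member of `𝒞`. -/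
def CircularArcDrawing.CoveredBy {d : ℕ} {V : Type*} {G : SimpleGraph V}
    (D : CircularArcDrawing d G) (𝒞 : Finset (Set (EuclideanSpace ℝ (Fin d)))) : Prop :=
  ∀ e ∈ G.edgeSet, ∃ C ∈ 𝒞, D.arc e ⊆ C

/-- All arcs of the drawing `D` are contained in the union of the family `𝒮` of
2-dimensional spheres in `ℝ³`. -/
def CircularArcDrawing.ArcsInSpheres {V : Type*} {G : SimpleGraph V}
    (D : CircularArcDrawing 3 G) (𝒮 : Finset (Set (EuclideanSpace ℝ (Fin 3)))) : Prop :=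
  (∀ S ∈ 𝒮, IsSphereDim 3 2 S) ∧ ∀ e ∈ G.edgeSet, D.arc e ⊆ ⋃ S ∈ 𝒮, S


namespace SphereCover

/-- Mod-2 indicator. -/
def ind (P : Prop) : ZMod 2 := by
  classical exact if P then 1 else 0

lemma ind_true {P : Prop} (h : P) : ind P = 1 := by simp [ind, h]
lemma ind_false {P : Prop} (h : ¬P) : ind P = 0 := by simp [ind, h]
lemma ind_congr {P Q : Prop} (h : P ↔ Q) : ind P = ind Q := by rw [propext h]
lemma ind_mul_ite (P : Prop) [Decidable P] (z : ZMod 2) : ind P * z = if P then z else 0 := by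
  by_cases h : P <;> simp [ind, h]
lemma z2_add_self (x : ZMod 2) : x + x = 0 := CharTwo.add_self_eq_zero x

/-- Telescoping over a finite set ordered by heights. -/
lemma telescope {ι M : Type*} [AddCommMonoid M] (h : ι → ℝ) (w : ι → M)
    (B : M) (φ : M → ZMod 2) (s : Finset ι) (hinj : Set.InjOn h s) :
    ∑ e ∈ s, (φ (B + ∑ e' ∈ s with h e' ≤ h e, w e') + φ (B + ∑ e' ∈ s with h e' < h e, w e'))
      = φ (B + ∑ e' ∈ s, w e') + φ B := by
  classical
  induction s using Finset.induction_on_max_value h with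
  | empty => simp [z2_add_self]
  | insert a s ha hmax ih =>
    have hlt : ∀ x ∈ s, h x < h a := by
      intro x hx
      refine lt_of_le_of_ne (hmax x hx) ?_
      intro hh
      have := hinj (by simp [hx]) (by simp) hh
      exact ha (this ▸ hx)
    have ih' := ih (hinj.mono (by simp))
    rw [Finset.sum_insert ha]
    have e1 : ∑ e' ∈ insert a s with h e' ≤ h a, w e' = ∑ e' ∈ insert a s, w e' := by
      congr 1
      apply Finset.filter_true_of_mem
      intro x hx
      rcases Finset.mem_insert.1 hx with rfl | hx
      · exact le_rfl
      · exact (hlt x hx).le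
    have e2 : ∑ e' ∈ insert a s with h e' < h a, w e' = ∑ e' ∈ s, w e' := by
      congr 1
      ext x
      simp only [Finset.mem_filter, Finset.mem_insert]
      constructor
      · rintro ⟨rfl | hx, h2⟩
        · exact absurd h2 (lt_irrefl _)
        · exact hx
      · intro hx; exact ⟨Or.inr hx, hlt x hx⟩
    have e3 : ∀ e ∈ s, (φ (B + ∑ e' ∈ insert a s with h e' ≤ h e, w e')
        + φ (B + ∑ e' ∈ insert a s with h e' < h e, w e'))
        = (φ (B + ∑ e' ∈ s with h e' ≤ h e, w e') + φ (B + ∑ e' ∈ s with h e' < h e, w e')) := by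
      intro e he
      have h1 := hlt e he
      rw [Finset.filter_insert, if_neg (not_le.2 h1), Finset.filter_insert,
        if_neg (not_lt.2 h1.le)]
    rw [Finset.sum_congr rfl e3, ih', e1, e2]
    have := z2_add_self (φ (B + ∑ e' ∈ s, w e'))
    linear_combination this

section Plane

variable {ε : Type} [Fintype ε]

/-- Incidence sum of a mod-2 chain `c` of `x`-monotone curves at the point `(x,y)`. -/
def inc (a b : ε → ℝ) (g : ε → ℝ → ℝ) (x y : ℝ) (e : ε) : ZMod 2 :=
  ind ((a e, g e (a e)) = (x, y)) + ind ((b e, g e (b e)) = (x, y))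

/-- Evenness. -/
def Even2 (a b : ε → ℝ) (g : ε → ℝ → ℝ) (c : ε → ZMod 2) : Prop :=
  ∀ x y, ∑ e, inc a b g x y e * c e = 0

/-- Sum over the vertices of abscissa `x` with `T`. -/
lemma even_fiber (a b : ε → ℝ) (g : ε → ℝ → ℝ) (c : ε → ZMod 2) (hc : Even2 a b g c)
    (x : ℝ) (T : ℝ → Prop) :
    ∑ e, (ind (a e = x ∧ T (g e x)) + ind (b e = x ∧ T (g e x))) * c e = 0 := by
  classical
  set Y : Finset ℝ := (Finset.univ.image (fun e => g e x)).filter T with hY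
  have : ∀ e, (ind (a e = x ∧ T (g e x)) + ind (b e = x ∧ T (g e x))) * c e
      = ∑ y ∈ Y, inc a b g x y e * c e := by
    intro e
    rw [← Finset.sum_mul]
    congr 1
    unfold inc
    rw [Finset.sum_add_distrib]
    have key : ∀ z : ℝ, ind (z = x ∧ T (g e x)) = ∑ y ∈ Y, ind ((z, g e z) = (x, y)) := by
      intro z
      by_cases hz : z = x
      · subst hz
        by_cases hT : T (g e z)
        · rw [ind_true ⟨rfl, hT⟩, Finset.sum_eq_single (g e z)]
          · rw [ind_true rfl]
          · intro y _ hy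
            apply ind_false
            intro h; exact hy (by simpa using (Prod.ext_iff.1 h).2.symm)
          · intro h; exfalso; apply h; simp [hY, hT]
        · rw [ind_false (by tauto)]
          symm
          apply Finset.sum_eq_zero
          intro y hy
          apply ind_false
          intro h
          simp only [Prod.mk.injEq, true_and] at h
          rw [hY, Finset.mem_filter] at hy
          exact hT (h ▸ hy.2)
      · rw [ind_false (by tauto)]
        symm
        apply Finset.sum_eq_zero
        intro y hy
        apply ind_false
        intro h
        exact hz (Prod.ext_iff.1 h).1
    rw [key, key]
  rw [Finset.sum_congr rfl (fun e _ => this e), Finset.sum_comm]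
  exact Finset.sum_eq_zero (fun y _ => hc x y)

/-- crossing parities: the number of curves of `c` over `x` (half-open) whose height relates
to `y` by `rel`. -/
def kap (a b : ε → ℝ) (g : ε → ℝ → ℝ) (rel : ℝ → ℝ → Prop) (x y : ℝ) (c : ε → ZMod 2) : ZMod 2 :=
  ∑ e, ind ((a e ≤ x ∧ x < b e) ∧ rel (g e x) y) * c e

/-- alternate half-open convention -/
def kap' (a b : ε → ℝ) (g : ε → ℝ → ℝ) (rel : ℝ → ℝ → Prop) (x y : ℝ) (c : ε → ZMod 2) : ZMod 2 :=
  ∑ e, ind ((a e < x ∧ x ≤ b e) ∧ rel (g e x) y) * c e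

lemma kap_eq_kap' (a b : ε → ℝ) (g : ε → ℝ → ℝ) (hab : ∀ e, a e < b e) (rel : ℝ → ℝ → Prop)
    (x y : ℝ) (c : ε → ZMod 2) (hc : Even2 a b g c) :
    kap a b g rel x y c = kap' a b g rel x y c := by
  have h := even_fiber a b g c hc x (fun z => rel z y)
  unfold kap kap'
  rw [← sub_eq_zero, ← Finset.sum_sub_distrib, ← h]
  apply Finset.sum_congr rfl
  intro e _
  rw [← sub_mul]
  congr 1
  have hh := hab e
  by_cases hr : rel (g e x) y
  · simp only [hr, and_true]
    rcases lt_trichotomy (a e) x with h1 | h1 | h1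
    · rcases lt_trichotomy x (b e) with h2 | h2 | h2
      · rw [ind_true ⟨h1.le, h2⟩, ind_true ⟨h1, h2.le⟩, ind_false h1.ne, ind_false h2.ne']; simp
      · rw [ind_false (fun h => h.2.ne h2), ind_true ⟨h1, h2.le⟩, ind_false h1.ne, ind_true h2.symm]
        decide
      · rw [ind_false (fun h => lt_asymm h.2 h2), ind_false (fun h => absurd h2 (not_lt.2 h.2)),
          ind_false h1.ne, ind_false h2.ne]; simp
    · have h2 : x < b e := h1 ▸ hh
      rw [ind_true ⟨h1.le, h2⟩, ind_false (fun h => h.1.ne h1), ind_true h1, ind_false h2.ne']; simp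
    · have h2 : x < b e := h1.trans hh
      rw [ind_false (fun h => absurd h1 (not_lt.2 h.1)), ind_false (fun h => lt_asymm h.1 h1),
          ind_false h1.ne', ind_false h2.ne']; simp
  · simp only [hr, and_false, ind_false not_false]; simp

/-- Noncrossing. -/
def NonCross (a b : ε → ℝ) (g : ε → ℝ → ℝ) : Prop :=
  ∀ e e', e ≠ e' → ∀ x, a e < x → x < b e → a e' ≤ x → x ≤ b e' → g e x ≠ g e' x

/-- Values just to the right of `x0`. -/
lemma kap_right (a b : ε → ℝ) (g : ε → ℝ → ℝ) (hg : ∀ e, Continuous (g e))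
    (rel : ℝ → ℝ → Prop) (hrel1 : ∀ s t, s < t → rel s t) (hrel2 : ∀ s t, t < s → ¬ rel s t)
    (x0 : ℝ) (e : ε) :
    ∀ᶠ x in nhdsWithin x0 (Ioi x0), ∀ c, kap a b g rel x (g e x) c =
      ∑ e', ind ((a e' ≤ x0 ∧ x0 < b e') ∧ (g e' x0 < g e x0 ∨ (g e' x0 = g e x0 ∧ rel (g e' x) (g e x)))) * c e' := by
  have : ∀ e', ∀ᶠ x in nhdsWithin x0 (Ioi x0),
      (((a e' ≤ x ∧ x < b e') ∧ rel (g e' x) (g e x)) ↔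
      ((a e' ≤ x0 ∧ x0 < b e') ∧ (g e' x0 < g e x0 ∨ (g e' x0 = g e x0 ∧ rel (g e' x) (g e x))))) := by
    intro e'
    have hr : ∀ᶠ x in nhdsWithin x0 (Ioi x0), x0 < x := self_mem_nhdsWithin
    have hab : ∀ᶠ x in nhdsWithin x0 (Ioi x0), (a e' ≤ x ∧ x < b e') ↔ (a e' ≤ x0 ∧ x0 < b e') := by
      have h1 : ∀ᶠ x in nhdsWithin x0 (Ioi x0), (a e' ≤ x ↔ a e' ≤ x0) := by
        rcases le_or_gt (a e') x0 with h | h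
        · filter_upwards [hr] with x hx
          exact ⟨fun _ => h, fun _ => h.trans hx.le⟩
        · filter_upwards [nhdsWithin_le_nhds (Iio_mem_nhds h)] with x hx
          exact ⟨fun h' => absurd hx (not_lt.2 h'), fun h' => absurd h (not_lt.2 h')⟩
      have h2 : ∀ᶠ x in nhdsWithin x0 (Ioi x0), (x < b e' ↔ x0 < b e') := by
        rcases lt_or_ge x0 (b e') with h | h
        · filter_upwards [nhdsWithin_le_nhds (Iio_mem_nhds h)] with x hx
          exact ⟨fun _ => h, fun _ => hx⟩
        · filter_upwards [hr] with x hx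
          exact ⟨fun h' => absurd (hx.trans h') (not_lt.2 h), fun h' => absurd h' (not_lt.2 h)⟩
      filter_upwards [h1, h2] with x h1 h2
      rw [h1, h2]
    rcases lt_trichotomy (g e' x0) (g e x0) with h | h | h
    · have : ∀ᶠ x in nhdsWithin x0 (Ioi x0), g e' x < g e x :=
        nhdsWithin_le_nhds ((hg e').continuousAt.eventually_lt (hg e).continuousAt h)
      filter_upwards [hab, this] with x h1 h2
      rw [h1]; simp [h, hrel1 _ _ h2]
    · filter_upwards [hab] with x h1
      rw [h1]; simp [h]
    · have : ∀ᶠ x in nhdsWithin x0 (Ioi x0), g e x < g e' x :=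
        nhdsWithin_le_nhds ((hg e).continuousAt.eventually_lt (hg e').continuousAt h)
      filter_upwards [hab, this] with x h1 h2
      rw [h1]; simp [hrel2 _ _ h2, not_lt.2 h.le, h.ne']
  have h2 := (Filter.eventually_all.2 this)
  filter_upwards [h2] with x hx c
  unfold kap
  exact Finset.sum_congr rfl (fun e' _ => by rw [ind_congr (hx e')])

/-- Values just to the left of `x0`. -/
lemma kap_left (a b : ε → ℝ) (g : ε → ℝ → ℝ) (hg : ∀ e, Continuous (g e))
    (rel : ℝ → ℝ → Prop) (hrel1 : ∀ s t, s < t → rel s t) (hrel2 : ∀ s t, t < s → ¬ rel s t)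
    (x0 : ℝ) (e : ε) :
    ∀ᶠ x in nhdsWithin x0 (Iio x0), ∀ c, kap a b g rel x (g e x) c =
      ∑ e', ind ((a e' < x0 ∧ x0 ≤ b e') ∧ (g e' x0 < g e x0 ∨ (g e' x0 = g e x0 ∧ rel (g e' x) (g e x)))) * c e' := by
  have : ∀ e', ∀ᶠ x in nhdsWithin x0 (Iio x0),
      (((a e' ≤ x ∧ x < b e') ∧ rel (g e' x) (g e x)) ↔
      ((a e' < x0 ∧ x0 ≤ b e') ∧ (g e' x0 < g e x0 ∨ (g e' x0 = g e x0 ∧ rel (g e' x) (g e x))))) := by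
    intro e'
    have hr : ∀ᶠ x in nhdsWithin x0 (Iio x0), x < x0 := self_mem_nhdsWithin
    have hab : ∀ᶠ x in nhdsWithin x0 (Iio x0), (a e' ≤ x ∧ x < b e') ↔ (a e' < x0 ∧ x0 ≤ b e') := by
      have h1 : ∀ᶠ x in nhdsWithin x0 (Iio x0), (a e' ≤ x ↔ a e' < x0) := by
        rcases lt_or_ge (a e') x0 with h | h
        · filter_upwards [nhdsWithin_le_nhds (Ioi_mem_nhds h)] with x hx
          exact ⟨fun _ => h, fun _ => (mem_Ioi.1 hx).le⟩
        · filter_upwards [hr] with x hx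
          exact ⟨fun h' => absurd (h'.trans_lt hx) (not_lt.2 h), fun h' => absurd h' (not_lt.2 h)⟩
      have h2 : ∀ᶠ x in nhdsWithin x0 (Iio x0), (x < b e' ↔ x0 ≤ b e') := by
        rcases le_or_gt x0 (b e') with h | h
        · filter_upwards [hr] with x hx
          exact ⟨fun _ => h, fun _ => hx.trans_le h⟩
        · filter_upwards [nhdsWithin_le_nhds (Ioi_mem_nhds h)] with x hx
          exact ⟨fun h' => absurd h' (lt_asymm hx), fun h' => absurd h (not_lt.2 h')⟩
      filter_upwards [h1, h2] with x h1 h2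
      rw [h1, h2]
    rcases lt_trichotomy (g e' x0) (g e x0) with h | h | h
    · have : ∀ᶠ x in nhdsWithin x0 (Iio x0), g e' x < g e x :=
        nhdsWithin_le_nhds ((hg e').continuousAt.eventually_lt (hg e).continuousAt h)
      filter_upwards [hab, this] with x h1 h2
      rw [h1]; simp [h, hrel1 _ _ h2]
    · filter_upwards [hab] with x h1
      rw [h1]; simp [h]
    · have : ∀ᶠ x in nhdsWithin x0 (Iio x0), g e x < g e' x :=
        nhdsWithin_le_nhds ((hg e).continuousAt.eventually_lt (hg e').continuousAt h)
      filter_upwards [hab, this] with x h1 h2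
      rw [h1]; simp [hrel2 _ _ h2, not_lt.2 h.le, h.ne']
  have h2 := (Filter.eventually_all.2 this)
  filter_upwards [h2] with x hx c
  unfold kap
  exact Finset.sum_congr rfl (fun e' _ => by rw [ind_congr (hx e')])

/-- Constancy of the crossing parity along an edge. -/
lemma kap_const (a b : ε → ℝ) (g : ε → ℝ → ℝ) (hab : ∀ e, a e < b e)
    (hg : ∀ e, Continuous (g e)) (hN : NonCross a b g)
    (rel : ℝ → ℝ → Prop) (hrel1 : ∀ s t, s < t → rel s t) (hrel2 : ∀ s t, t < s → ¬ rel s t)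
    (hrel3 : ∀ s t, rel s s ↔ rel t t)
    (e : ε) (c : ε → ZMod 2) (hc : Even2 a b g c) (x x' : ℝ) (hx : x ∈ Ioo (a e) (b e))
    (hx' : x' ∈ Ioo (a e) (b e)) :
    kap a b g rel x (g e x) c = kap a b g rel x' (g e x') c := by
  refine (isPreconnected_Ioo (a := a e) (b := b e)).constant
    (f := fun x => kap a b g rel x (g e x) c) ?_ hx hx'
  intro x0 hx0
  apply ContinuousAt.continuousWithinAt
  have hev : ∀ᶠ x in nhds x0, kap a b g rel x (g e x) c = kap a b g rel x0 (g e x0) c := by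
    rw [← nhdsNE_sup_pure, ← nhdsLT_sup_nhdsGT, Filter.eventually_sup, Filter.eventually_sup]
    refine ⟨⟨?_, ?_⟩, by simp⟩
    · filter_upwards [kap_left a b g hg rel hrel1 hrel2 x0 e] with x hx
      rw [hx c, kap_eq_kap' a b g hab rel x0 _ c hc]
      unfold kap'
      apply Finset.sum_congr rfl
      intro e' _
      congr 1
      apply ind_congr
      by_cases he : e' = e
      · subst he
        simp [hrel3 (g e' x) (g e' x0)]
      · constructor
        · rintro ⟨h1, h2⟩
          refine ⟨h1, ?_⟩
          rcases h2 with h2 | h2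
          · exact hrel1 _ _ h2
          · exact absurd h2.1.symm (hN e e' (Ne.symm he) x0 hx0.1 hx0.2 h1.1.le h1.2)
        · rintro ⟨h1, h2⟩
          refine ⟨h1, ?_⟩
          rcases lt_trichotomy (g e' x0) (g e x0) with h3 | h3 | h3
          · exact Or.inl h3
          · exact absurd h3.symm (hN e e' (Ne.symm he) x0 hx0.1 hx0.2 h1.1.le h1.2)
          · exact absurd h2 (hrel2 _ _ h3)
    · filter_upwards [kap_right a b g hg rel hrel1 hrel2 x0 e] with x hx
      rw [hx c]
      unfold kap
      apply Finset.sum_congr rfl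
      intro e' _
      congr 1
      apply ind_congr
      by_cases he : e' = e
      · subst he
        simp [hrel3 (g e' x) (g e' x0)]
      · constructor
        · rintro ⟨h1, h2⟩
          refine ⟨h1, ?_⟩
          rcases h2 with h2 | h2
          · exact hrel1 _ _ h2
          · exact absurd h2.1.symm (hN e e' (Ne.symm he) x0 hx0.1 hx0.2 h1.1 h1.2.le)
        · rintro ⟨h1, h2⟩
          refine ⟨h1, ?_⟩
          rcases lt_trichotomy (g e' x0) (g e x0) with h3 | h3 | h3
          · exact Or.inl h3
          · exact absurd h3.symm (hN e e' (Ne.symm he) x0 hx0.1 hx0.2 h1.1 h1.2.le)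
          · exact absurd h2 (hrel2 _ _ h3)
  exact (continuousAt_const (y := kap a b g rel x0 (g e x0) c)).congr (hev.mono fun _ h => h.symm)

/-- sum over edges emanating from one point, general version. -/
lemma vertex_side {ε : Type*} (S : Finset ε) (C : Set (ε → ZMod 2)) (B : (ε → ZMod 2) → ZMod 2)
    (h : ε → ℝ) (hinj : Set.InjOn h S) (φ : (C → ZMod 2) → ZMod 2)
    (Lf Rf : ε → C → ZMod 2)
    (hL : ∀ e ∈ S, ∀ c : C, Lf e c = B c + ∑ e' ∈ S with h e' < h e, c.1 e')
    (hR : ∀ e ∈ S, ∀ c : C, Rf e c = B c + ∑ e' ∈ S with h e' ≤ h e, c.1 e') :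
    ∑ e ∈ S, (φ (Lf e) + φ (Rf e)) =
      φ (fun c => B c + ∑ e' ∈ S, c.1 e') + φ (fun c => B c) := by
  have := telescope (M := C → ZMod 2) h (fun e c => c.1 e) (fun c => B c) φ S hinj
  have conv : ∀ T : Finset ε, ((fun c : C => B c) + ∑ e' ∈ T, fun c : C => c.1 e')
      = fun c : C => B c + ∑ e' ∈ T, c.1 e' := by
    intro T; funext c; simp [Finset.sum_apply]
  rw [conv] at this
  rw [← this]
  apply Finset.sum_congr rfl
  intro e he
  rw [conv, conv, add_comm]
  congr 2
  · funext c; exact hR e he c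
  · funext c; exact hL e he c

lemma sum_ind_filter (S : Finset ε) (r : ε → Prop) [DecidablePred r] (c : ε → ZMod 2) :
    ∑ e, ind (e ∈ S ∧ r e) * c e = ∑ e ∈ S with r e, c e := by
  classical
  rw [Finset.sum_filter, ← Finset.sum_filter_add_sum_filter_not Finset.univ (· ∈ S)]
  have h1 : ∑ e with e ∉ S, ind (e ∈ S ∧ r e) * c e = 0 := by
    apply Finset.sum_eq_zero
    intro e he
    rw [Finset.mem_filter] at he
    rw [ind_false (fun h => he.2 h.1), zero_mul]
  rw [h1, add_zero]
  have h2 : (Finset.univ.filter (· ∈ S)) = S := by ext; simp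
  rw [h2]
  apply Finset.sum_congr rfl
  intro e he
  by_cases hr : r e
  · rw [ind_true ⟨he, hr⟩, if_pos hr, one_mul]
  · rw [ind_false (fun h => hr h.2), if_neg hr, zero_mul]

lemma ind_split (A l q r m : Prop) (hlq : l → ¬ q) (hA : m ↔ (A ∧ q)) :
    ind (A ∧ (l ∨ (q ∧ r))) = ind (A ∧ l) + ind (m ∧ r) := by
  by_cases hA' : A <;> by_cases hl : l <;> by_cases hq : q <;> by_cases hr : r <;>
    by_cases hm : m <;> simp_all [ind]

/-- Existence of the algebraic dual for a noncrossing family of `x`-monotone curves. -/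
theorem plane_dual (a b : ε → ℝ) (g : ε → ℝ → ℝ) (hab : ∀ e, a e < b e)
    (hg : ∀ e, Continuous (g e)) (hN : NonCross a b g) :
    ∃ (Φ : Type) (L R : ε → Φ),
      (∀ F x y, ∑ e, inc a b g x y e * (ind (L e = F) + ind (R e = F)) = 0) ∧
      (∀ c, Even2 a b g c → ∃ f : Φ → ZMod 2, ∀ e, f (L e) + f (R e) = c e) := by
  classical
  set C : Set (ε → ZMod 2) := {c | Even2 a b g c} with hC
  set m : ε → ℝ := fun e => (a e + b e) / 2 with hm
  have hmI : ∀ e, m e ∈ Ioo (a e) (b e) := fun e => by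
    have := hab e
    constructor <;> simp only [hm] <;> linarith
  set Lf : ε → C → ZMod 2 := fun e c => kap a b g (· < ·) (m e) (g e (m e)) c.1 with hLf
  set Rf : ε → C → ZMod 2 := fun e c => kap a b g (· ≤ ·) (m e) (g e (m e)) c.1 with hRf
  have hLc : ∀ e x, x ∈ Ioo (a e) (b e) → ∀ c : C, Lf e c = kap a b g (· < ·) x (g e x) c.1 :=
    fun e x hx c => kap_const a b g hab hg hN (· < ·) (fun _ _ h => h) (fun _ _ h => lt_asymm h)
      (by simp) e c.1 c.2 _ _ (hmI e) hx
  have hRc : ∀ e x, x ∈ Ioo (a e) (b e) → ∀ c : C, Rf e c = kap a b g (· ≤ ·) x (g e x) c.1 :=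
    fun e x hx c => kap_const a b g hab hg hN (· ≤ ·) (fun _ _ h => h.le) (fun _ _ h => not_le.2 h)
      (by simp) e c.1 c.2 _ _ (hmI e) hx
  refine ⟨C → ZMod 2, Lf, Rf, ?_, ?_⟩
  · intro F x0 y0
    set φ : (C → ZMod 2) → ZMod 2 := fun k => ind (k = F) with hφ
    set Rt : Finset ε := Finset.univ.filter (fun e => (a e, g e (a e)) = (x0, y0)) with hRt
    set Lt : Finset ε := Finset.univ.filter (fun e => (b e, g e (b e)) = (x0, y0)) with hLt
    have mR : ∀ e, e ∈ Rt ↔ a e = x0 ∧ g e x0 = y0 := by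
      intro e
      simp only [hRt, Finset.mem_filter, Finset.mem_univ, true_and, Prod.mk.injEq]
      constructor <;> (rintro ⟨rfl, h⟩; exact ⟨rfl, h⟩)
    have mL : ∀ e, e ∈ Lt ↔ b e = x0 ∧ g e x0 = y0 := by
      intro e
      simp only [hLt, Finset.mem_filter, Finset.mem_univ, true_and, Prod.mk.injEq]
      constructor <;> (rintro ⟨rfl, h⟩; exact ⟨rfl, h⟩)
    have split : ∑ e, inc a b g x0 y0 e * (ind (Lf e = F) + ind (Rf e = F))
        = ∑ e ∈ Rt, (φ (Lf e) + φ (Rf e)) + ∑ e ∈ Lt, (φ (Lf e) + φ (Rf e)) := by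
      rw [hRt, hLt, Finset.sum_filter, Finset.sum_filter, ← Finset.sum_add_distrib]
      apply Finset.sum_congr rfl
      intro e _
      unfold inc
      rw [add_mul]
      congr 1
      · exact ind_mul_ite _ _
      · exact ind_mul_ite _ _
    rw [split]
    -- general helper: the values at the vertex
    have top : ∀ c : C, kap a b g (· < ·) x0 y0 c.1 + ∑ e' ∈ Rt, c.1 e'
        = kap' a b g (· < ·) x0 y0 c.1 + ∑ e' ∈ Lt, c.1 e' := by
      intro c
      rw [kap_eq_kap' a b g hab _ _ _ _ c.2]
      congr 1
      have h := c.2 x0 y0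
      unfold inc at h
      simp only [add_mul] at h
      rw [Finset.sum_add_distrib] at h
      have e1 : ∀ S : Finset ε, ∀ Q : ε → Prop, (∀ e, e ∈ S ↔ Q e) →
          ∑ e, ind (Q e) * c.1 e = ∑ e ∈ S, c.1 e := by
        intro S Q hQ
        have := sum_ind_filter S (fun _ => True) c.1
        simp only [and_true, Finset.filter_true] at this
        rw [← this]
        exact Finset.sum_congr rfl (fun e _ => by rw [ind_congr (hQ e)])
      rw [e1 Rt _ (by intro e; simp [hRt]), e1 Lt _ (by intro e; simp [hLt])] at h
      have h2 := z2_add_self (∑ e ∈ Lt, c.1 e)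
      linear_combination h - h2
    -- right side
    have hright : ∑ e ∈ Rt, (φ (Lf e) + φ (Rf e)) =
        φ (fun c => kap a b g (· < ·) x0 y0 c.1 + ∑ e' ∈ Rt, c.1 e')
          + φ (fun c => kap a b g (· < ·) x0 y0 c.1) := by
      have ev1 := Filter.eventually_all.2 (fun e => kap_right a b g hg (· < ·) (fun _ _ h => h)
        (fun _ _ h => lt_asymm h) x0 e)
      have ev2 := Filter.eventually_all.2 (fun e => kap_right a b g hg (· ≤ ·) (fun _ _ h => h.le)
        (fun _ _ h => not_le.2 h) x0 e)
      have ev3 : ∀ᶠ x in nhdsWithin x0 (Ioi x0), ∀ e, x0 < b e → x < b e := by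
        rw [Filter.eventually_all]
        intro e
        by_cases h : x0 < b e
        · filter_upwards [nhdsWithin_le_nhds (Iio_mem_nhds h)] with x hx _ using hx
        · exact Filter.Eventually.of_forall (fun x hx => absurd hx h)
      have ev4 : ∀ᶠ x in nhdsWithin x0 (Ioi x0), x0 < x := self_mem_nhdsWithin
      obtain ⟨x, ⟨⟨h1, h2⟩, h3⟩, h4⟩ := (((ev1.and ev2).and ev3).and ev4).exists
      have hxI : ∀ e ∈ Rt, x ∈ Ioo (a e) (b e) := by
        intro e he
        have hae := ((mR e).1 he).1
        exact ⟨hae ▸ h4, h3 e (hae ▸ hab e)⟩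
      have mem : ∀ e ∈ Rt, ∀ e', e' ∈ Rt ↔ ((a e' ≤ x0 ∧ x0 < b e') ∧ g e' x0 = g e x0) := by
        intro e he e'
        have hee := (mR e).1 he
        rw [mR e', hee.2]
        constructor
        · rintro ⟨h5, h6⟩
          exact ⟨⟨h5.le, h5 ▸ hab e'⟩, h6⟩
        · rintro ⟨⟨h5, h6⟩, h7⟩
          refine ⟨?_, h7⟩
          by_contra hne
          have h8 := lt_of_le_of_ne h5 hne
          refine hN e' e ?_ x0 h8 h6 hee.1.le (hee.1 ▸ (hab e).le) (h7.trans hee.2.symm)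
          rintro rfl; exact hne hee.1
      apply vertex_side Rt C (fun c => kap a b g (· < ·) x0 y0 c) (fun e => g e x)
      · intro e he e' he' heq
        by_contra hne
        have i1 := hxI e he
        have i2 := hxI e' he'
        exact hN e e' hne x i1.1 i1.2 i2.1.le i2.2.le heq
      · intro e he c
        rw [hLc e x (hxI e he), h1 e c.1, ← sum_ind_filter]
        unfold kap
        rw [← Finset.sum_add_distrib]
        apply Finset.sum_congr rfl
        intro e' _
        rw [← add_mul, ind_split _ _ _ _ _ (fun h => h.ne) (mem e he e'), ((mR e).1 he).2]
      · intro e he c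
        rw [hRc e x (hxI e he), h2 e c.1, ← sum_ind_filter]
        unfold kap
        rw [← Finset.sum_add_distrib]
        apply Finset.sum_congr rfl
        intro e' _
        rw [← add_mul, ind_split _ _ _ _ _ (fun h => h.ne) (mem e he e'), ((mR e).1 he).2]
    have hleft : ∑ e ∈ Lt, (φ (Lf e) + φ (Rf e)) =
        φ (fun c => kap' a b g (· < ·) x0 y0 c.1 + ∑ e' ∈ Lt, c.1 e')
          + φ (fun c => kap' a b g (· < ·) x0 y0 c.1) := by
      have ev1 := Filter.eventually_all.2 (fun e => kap_left a b g hg (· < ·) (fun _ _ h => h)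
        (fun _ _ h => lt_asymm h) x0 e)
      have ev2 := Filter.eventually_all.2 (fun e => kap_left a b g hg (· ≤ ·) (fun _ _ h => h.le)
        (fun _ _ h => not_le.2 h) x0 e)
      have ev3 : ∀ᶠ x in nhdsWithin x0 (Iio x0), ∀ e, a e < x0 → a e < x := by
        rw [Filter.eventually_all]
        intro e
        by_cases h : a e < x0
        · filter_upwards [nhdsWithin_le_nhds (Ioi_mem_nhds h)] with x hx _ using hx
        · exact Filter.Eventually.of_forall (fun x hx => absurd hx h)
      have ev4 : ∀ᶠ x in nhdsWithin x0 (Iio x0), x < x0 := self_mem_nhdsWithin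
      obtain ⟨x, ⟨⟨h1, h2⟩, h3⟩, h4⟩ := (((ev1.and ev2).and ev3).and ev4).exists
      have hxI : ∀ e ∈ Lt, x ∈ Ioo (a e) (b e) := by
        intro e he
        have hae := ((mL e).1 he).1
        exact ⟨h3 e (hae ▸ hab e), hae ▸ h4⟩
      have mem : ∀ e ∈ Lt, ∀ e', e' ∈ Lt ↔ ((a e' < x0 ∧ x0 ≤ b e') ∧ g e' x0 = g e x0) := by
        intro e he e'
        have hee := (mL e).1 he
        rw [mL e', hee.2]
        constructor
        · rintro ⟨h5, h6⟩
          exact ⟨⟨h5 ▸ hab e', h5.ge⟩, h6⟩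
        · rintro ⟨⟨h5, h6⟩, h7⟩
          refine ⟨?_, h7⟩
          by_contra hne
          have h8 := lt_of_le_of_ne h6 (Ne.symm hne)
          refine hN e' e ?_ x0 h5 h8 (hee.1 ▸ (hab e).le) hee.1.ge (h7.trans hee.2.symm)
          rintro rfl; exact hne hee.1
      apply vertex_side Lt C (fun c => kap' a b g (· < ·) x0 y0 c) (fun e => g e x)
      · intro e he e' he' heq
        by_contra hne
        have i1 := hxI e he
        have i2 := hxI e' he'
        exact hN e e' hne x i1.1 i1.2 i2.1.le i2.2.le heq
      · intro e he c
        rw [hLc e x (hxI e he), h1 e c.1, ← sum_ind_filter]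
        unfold kap'
        rw [← Finset.sum_add_distrib]
        apply Finset.sum_congr rfl
        intro e' _
        rw [← add_mul, ind_split _ _ _ _ _ (fun h => h.ne) (mem e he e'), ((mL e).1 he).2]
      · intro e he c
        rw [hRc e x (hxI e he), h2 e c.1, ← sum_ind_filter]
        unfold kap'
        rw [← Finset.sum_add_distrib]
        apply Finset.sum_congr rfl
        intro e' _
        rw [← add_mul, ind_split _ _ _ _ _ (fun h => h.ne) (mem e he e'), ((mL e).1 he).2]
    rw [hright, hleft]
    have t1 : (fun c : C => kap a b g (· < ·) x0 y0 c.1 + ∑ e' ∈ Rt, c.1 e')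
        = fun c : C => kap' a b g (· < ·) x0 y0 c.1 + ∑ e' ∈ Lt, c.1 e' := funext top
    have t2 : (fun c : C => kap a b g (· < ·) x0 y0 c.1)
        = fun c : C => kap' a b g (· < ·) x0 y0 c.1 :=
      funext fun c => kap_eq_kap' a b g hab _ _ _ _ c.2
    rw [t1, t2]
    exact z2_add_self _
  · intro c hc
    refine ⟨fun k => k ⟨c, hc⟩, fun e => ?_⟩
    simp only [hLf, hRf]
    unfold kap
    rw [← Finset.sum_add_distrib, Finset.sum_eq_single e]
    · rw [ind_false (by simp), ind_true ⟨⟨(hmI e).1.le, (hmI e).2⟩, le_rfl⟩]; simp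
    · intro e' _ hne
      rw [← add_mul]
      have : ind ((a e' ≤ m e ∧ m e < b e') ∧ g e' (m e) < g e (m e))
          = ind ((a e' ≤ m e ∧ m e < b e') ∧ g e' (m e) ≤ g e (m e)) := by
        apply ind_congr
        constructor
        · rintro ⟨h1, h2⟩; exact ⟨h1, h2.le⟩
        · rintro ⟨h1, h2⟩
          exact ⟨h1, lt_of_le_of_ne h2
            (Ne.symm (hN e e' (Ne.symm hne) _ (hmI e).1 (hmI e).2 h1.1 h1.2.le))⟩
      rw [this, z2_add_self, zero_mul]
    · simp

end Plane
end SphereCover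

namespace SphereCover

lemma exists_other {ε : Type} [Fintype ε] (Q : ε → Prop) (c : ε → ZMod 2)
    (h : ∑ e, ind (Q e) * c e = 0) (e0 : ε) (hQ : Q e0) (hc : c e0 ≠ 0) :
    ∃ e1, e1 ≠ e0 ∧ Q e1 ∧ c e1 ≠ 0 := by
  classical
  by_contra hcon
  push Not at hcon
  apply hc
  rw [← h, Finset.sum_eq_single e0, ind_true hQ, one_mul]
  · intro e _ hne
    by_cases hq : Q e
    · rw [hcon e hne hq, mul_zero]
    · rw [ind_false hq, zero_mul]
  · simp

lemma four_le {ε : Type} [Fintype ε] {p q : ℕ} (s : ε → Fin p) (t : ε → Fin q)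
    (hinj : ∀ e e', s e = s e' → t e = t e' → e = e') (c : ε → ZMod 2)
    (hs : ∀ i, ∑ e, ind (s e = i) * c e = 0) (ht : ∀ j, ∑ e, ind (t e = j) * c e = 0)
    (hc : c ≠ 0) : 4 ≤ (Finset.univ.filter (fun e => c e ≠ 0)).card := by
  classical
  obtain ⟨e0, h0⟩ := Function.ne_iff.1 hc
  obtain ⟨e1, n1, s1, h1⟩ := exists_other _ c (hs (s e0)) e0 rfl h0
  obtain ⟨e2, n2, t2, h2⟩ := exists_other _ c (ht (t e0)) e0 rfl h0
  obtain ⟨e3, n3, t3, h3⟩ := exists_other _ c (ht (t e1)) e1 rfl h1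
  have n12 : e1 ≠ e2 := by rintro rfl; exact n1 (hinj _ _ s1 t2)
  have n30 : e3 ≠ e0 := by
    rintro rfl; exact n1 (hinj _ _ s1 t3.symm)
  have n32 : e3 ≠ e2 := by
    rintro rfl; exact n1 (hinj _ _ s1 (t3.symm.trans t2))
  have hsub : ({e0, e1, e2, e3} : Finset ε) ⊆ Finset.univ.filter (fun e => c e ≠ 0) := by
    intro e he
    simp only [Finset.mem_insert, Finset.mem_singleton] at he
    rw [Finset.mem_filter]
    refine ⟨Finset.mem_univ _, ?_⟩
    rcases he with rfl | rfl | rfl | rfl <;> assumption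
  refine le_trans (le_of_eq ?_) (Finset.card_le_card hsub)
  rw [Finset.card_insert_of_notMem, Finset.card_insert_of_notMem, Finset.card_insert_of_notMem,
    Finset.card_singleton]
  · simpa using n32.symm
  · simp [n12, n3.symm]
  · simp [n1.symm, n2.symm, n30.symm]

theorem comb_bound {ε : Type} [Fintype ε] {p q : ℕ} (hp : 1 ≤ p) (hpq : 3 ≤ p + q)
    (s : ε → Fin p) (t : ε → Fin q)
    (hinj : ∀ e e', s e = s e' → t e = t e' → e = e') {Φ : Type} (L R : ε → Φ)
    (h2s : ∀ F i, ∑ e, ind (s e = i) * (ind (L e = F) + ind (R e = F)) = 0)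
    (h2t : ∀ F j, ∑ e, ind (t e = j) * (ind (L e = F) + ind (R e = F)) = 0)
    (h3 : ∀ c : ε → ZMod 2, (∀ i, ∑ e, ind (s e = i) * c e = 0) →
      (∀ j, ∑ e, ind (t e = j) * c e = 0) → ∃ f : Φ → ZMod 2, ∀ e, f (L e) + f (R e) = c e) :
    Fintype.card ε + 4 ≤ 2 * (p + q) := by
  classical
  -- the boundary map
  let δ : (ε → ZMod 2) →ₗ[ZMod 2] ((Fin p ⊕ Fin q) → ZMod 2) :=
    { toFun := fun c => Sum.elim (fun i => ∑ e, ind (s e = i) * c e)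
        (fun j => ∑ e, ind (t e = j) * c e)
      map_add' := by
        intro c d; funext v
        rcases v with v | v <;> simp [mul_add, Finset.sum_add_distrib]
      map_smul' := by
        intro r c; funext v
        rcases v with v | v <;> simp [Finset.mul_sum, mul_left_comm] }
  let χ : ((Fin p ⊕ Fin q) → ZMod 2) →ₗ[ZMod 2] ZMod 2 :=
    { toFun := fun w => ∑ v, w v
      map_add' := by intro c d; simp [Finset.sum_add_distrib]
      map_smul' := by intro r c; simp only [Pi.smul_apply, smul_eq_mul, RingHom.id_apply]; rw [Finset.mul_sum] }
  have hδ : ∀ c, δ c = 0 ↔ ((∀ i, ∑ e, ind (s e = i) * c e = 0) ∧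
      (∀ j, ∑ e, ind (t e = j) * c e = 0)) := by
    intro c
    constructor
    · intro h
      exact ⟨fun i => congrFun h (Sum.inl i), fun j => congrFun h (Sum.inr j)⟩
    · rintro ⟨h1, h2⟩
      funext v
      rcases v with v | v
      · exact h1 v
      · exact h2 v
  have hsum1 : ∀ {n : ℕ} (k : Fin n), ∑ i, ind (k = i) = 1 := by
    intro n k
    rw [Finset.sum_eq_single k, ind_true rfl]
    · intro b _ hb; exact ind_false (Ne.symm hb)
    · simp
  have hr : LinearMap.range δ ≤ LinearMap.ker χ := by
    rintro _ ⟨c, rfl⟩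
    rw [LinearMap.mem_ker]
    change ∑ v, Sum.elim (fun i => ∑ e, ind (s e = i) * c e)
        (fun j => ∑ e, ind (t e = j) * c e) v = 0
    rw [Fintype.sum_sum_type]
    simp only [Sum.elim_inl, Sum.elim_inr]
    rw [Finset.sum_comm, Finset.sum_comm (s := (Finset.univ : Finset (Fin q)))]
    simp only [← Finset.sum_mul, hsum1, one_mul]
    exact z2_add_self _
  have d1 := LinearMap.finrank_range_add_finrank_ker δ
  have d2 := LinearMap.finrank_range_add_finrank_ker χ
  have d3 := Submodule.finrank_mono hr
  have d4 : 1 ≤ Module.finrank (ZMod 2) (LinearMap.range χ) := by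
    rw [Nat.one_le_iff_ne_zero]
    intro h0
    rw [Submodule.finrank_eq_zero] at h0
    have : χ (Pi.single (Sum.inl ⟨0, hp⟩) 1) = 0 := by
      have : χ (Pi.single (Sum.inl ⟨0, hp⟩) 1) ∈ LinearMap.range χ := ⟨_, rfl⟩
      rw [h0] at this
      exact (Submodule.mem_bot _).1 this
    have h1 : χ (Pi.single (Sum.inl ⟨0, hp⟩) 1) = 1 := by
      change ∑ v, (Pi.single (Sum.inl ⟨0, hp⟩) 1 : (Fin p ⊕ Fin q) → ZMod 2) v = 1
      rw [Finset.sum_pi_single']; simp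
    rw [h1] at this
    exact one_ne_zero this
  simp only [Module.finrank_fintype_fun_eq_card, Fintype.card_sum, Fintype.card_fin] at d1 d2
  -- faces
  let DF : Φ → ε → ZMod 2 := fun F e => ind (L e = F) + ind (R e = F)
  let Φ0 : Finset Φ := Finset.univ.image L ∪ Finset.univ.image R
  let N : Finset Φ := Φ0.filter (fun F => DF F ≠ 0)
  have hL0 : ∀ e, L e ∈ Φ0 := fun e => by simp [Φ0]
  have hR0 : ∀ e, R e ∈ Φ0 := fun e => by simp [Φ0]
  have hsumind : ∀ (f : Φ → ZMod 2) (k : Φ), k ∈ Φ0 → ∑ F ∈ Φ0, f F * ind (k = F) = f k := by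
    intro f k hk
    rw [Finset.sum_eq_single k, ind_true rfl, mul_one]
    · intro b _ hb; rw [ind_false (Ne.symm hb), mul_zero]
    · intro h; exact absurd hk h
  let T : (N → ZMod 2) →ₗ[ZMod 2] (ε → ZMod 2) :=
    Fintype.linearCombination (ZMod 2) (fun F : N => DF F.1)
  have hT : ∀ f : Φ → ZMod 2, T (fun F => f F.1) = fun e => f (L e) + f (R e) := by
    intro f
    have : T (fun F => f F.1) = ∑ F ∈ N, f F • DF F := by
      rw [Fintype.linearCombination_apply]
      exact (Finset.sum_coe_sort N (fun F => f F • DF F))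
    rw [this, Finset.sum_filter_of_ne]
    · funext e
      simp only [Finset.sum_apply, Pi.smul_apply, smul_eq_mul, DF, mul_add, Finset.sum_add_distrib]
      rw [hsumind f _ (hL0 e), hsumind f _ (hR0 e)]
    · intro F _ h h0; rw [h0, smul_zero] at h; exact h rfl
  have hker : LinearMap.ker δ ≤ LinearMap.range T := by
    intro c hc
    rw [LinearMap.mem_ker, hδ] at hc
    obtain ⟨f, hf⟩ := h3 c hc.1 hc.2
    exact ⟨_, (hT f).trans (funext hf)⟩
  have d5 := Submodule.finrank_mono hker
  have d6 := LinearMap.finrank_range_add_finrank_ker T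
  simp only [Module.finrank_fintype_fun_eq_card, Fintype.card_coe] at d6
  -- double counting
  have dc : 4 * N.card ≤ 2 * Fintype.card ε := by
    have h4 : ∀ F ∈ N, 4 ≤ (Finset.univ.filter (fun e => DF F e ≠ 0)).card := by
      intro F hF
      exact four_le s t hinj (DF F) (h2s F) (h2t F) (Finset.mem_filter.1 hF).2
    calc 4 * N.card = ∑ F ∈ N, 4 := by simp [mul_comm]
      _ ≤ ∑ F ∈ N, (Finset.univ.filter (fun e => DF F e ≠ 0)).card := Finset.sum_le_sum h4
      _ = ∑ e, (N.filter (fun F => DF F e ≠ 0)).card :=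
          Finset.sum_card_bipartiteAbove_eq_sum_card_bipartiteBelow _
      _ ≤ ∑ e : ε, 2 := by
          apply Finset.sum_le_sum
          intro e _
          have : N.filter (fun F => DF F e ≠ 0) ⊆ {L e, R e} := by
            intro F hF
            have h1 := (Finset.mem_filter.1 hF).2
            by_contra h2
            simp only [Finset.mem_insert, Finset.mem_singleton, not_or] at h2
            apply h1
            simp only [DF]
            rw [ind_false (Ne.symm h2.1), ind_false (Ne.symm h2.2), add_zero]
          exact (Finset.card_le_card this).trans Finset.card_le_two
      _ = 2 * Fintype.card ε := by simp [mul_comm]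
  rcases N.eq_empty_or_nonempty with hN | hN
  · have hN0 : N.card = 0 := Finset.card_eq_zero.2 hN
    omega
  · have d7 : 1 ≤ Module.finrank (ZMod 2) (LinearMap.ker T) := by
      rw [Nat.one_le_iff_ne_zero]
      intro h0
      rw [Submodule.finrank_eq_zero] at h0
      have h1 : (fun _ => 1 : N → ZMod 2) ∈ LinearMap.ker T := by
        rw [LinearMap.mem_ker]
        have := hT (fun _ => 1)
        rw [this]
        funext e; exact z2_add_self 1
      rw [h0, Submodule.mem_bot] at h1
      obtain ⟨F, hF⟩ := hN
      exact one_ne_zero (congrFun h1 ⟨F, hF⟩)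
    omega

end SphereCover

namespace SphereCover

/-- `A` contains a chain of `x`-monotone curves joining `u` and `v`. -/
structure Chain (A : Set (ℝ × ℝ)) (u v : ℝ × ℝ) where
  n : ℕ
  P : ℕ → ℝ × ℝ
  a : ℕ → ℝ
  b : ℕ → ℝ
  g : ℕ → ℝ → ℝ
  npos : 0 < n
  ends : (P 0 = u ∧ P n = v) ∨ (P 0 = v ∧ P n = u)
  inj : ∀ i j, i ≤ n → j ≤ n → P i = P j → i = j
  lt : ∀ i < n, a i < b i
  cont : ∀ i, Continuous (g i)
  side : ∀ i < n, ((a i, g i (a i)) = P i ∧ (b i, g i (b i)) = P (i + 1)) ∨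
    ((a i, g i (a i)) = P (i + 1) ∧ (b i, g i (b i)) = P i)
  mem : ∀ i < n, ∀ x ∈ Icc (a i) (b i), (x, g i x) ∈ A
  disj : ∀ i < n, ∀ j < n, i ≠ j → ∀ x ∈ Ioo (a i) (b i), x ∈ Icc (a j) (b j) → g i x ≠ g j x
  notP : ∀ i < n, ∀ x ∈ Ioo (a i) (b i), ∀ k ≤ n, (x, g i x) ≠ P k

lemma partition_exists (m : ℕ) : ∀ (α β : ℝ), α < β → β ≤ (⌊α / Real.pi⌋ + m + 1) * Real.pi →
    ∃ (n : ℕ) (t : ℕ → ℝ), 0 < n ∧ t 0 = α ∧ t n = β ∧ (∀ i < n, t i < t (i + 1)) ∧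
      ∀ i < n, ∃ k : ℤ, k * Real.pi ≤ t i ∧ t (i + 1) ≤ (k + 1) * Real.pi := by
  have hpi := Real.pi_pos
  induction m with
  | zero =>
    intro α β h1 h2
    refine ⟨1, fun i => if i = 0 then α else β, one_pos, by simp, by simp, ?_, ?_⟩
    · intro i hi
      obtain rfl : i = 0 := by omega
      simpa using h1
    · intro i hi
      obtain rfl : i = 0 := by omega
      refine ⟨⌊α / Real.pi⌋, ?_, ?_⟩
      · simp only [if_pos]
        rw [← le_div_iff₀ hpi]; exact Int.floor_le _
      · simpa using h2
  | succ m ih =>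
    intro α β h1 h2
    set k := ⌊α / Real.pi⌋ with hk
    have hk1 : (k : ℝ) * Real.pi ≤ α := by
      rw [← le_div_iff₀ hpi]; exact Int.floor_le _
    have hk2 : α < (k + 1) * Real.pi := by
      rw [← div_lt_iff₀ hpi]; exact Int.lt_floor_add_one _
    rcases le_or_gt β ((k + 1) * Real.pi) with h | h
    · refine ⟨1, fun i => if i = 0 then α else β, one_pos, by simp, by simp, ?_, ?_⟩
      · intro i hi
        obtain rfl : i = 0 := by omega
        simpa using h1
      · intro i hi
        obtain rfl : i = 0 := by omega
        refine ⟨k, ?_, ?_⟩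
        · simpa using hk1
        · simpa using h
    · have hf : ⌊((k + 1 : ℝ) * Real.pi) / Real.pi⌋ = k + 1 := by
        rw [mul_div_assoc, div_self hpi.ne', mul_one]
        exact_mod_cast Int.floor_intCast (R := ℝ) (k + 1)
      obtain ⟨n, t, hn, h0, hl, hm, hp⟩ := ih _ β h (by
        rw [hf]; push_cast at h2 ⊢; linarith)
      refine ⟨n + 1, fun i => if i = 0 then α else t (i - 1), by omega, by simp, by simp [hl], ?_, ?_⟩
      · intro i hi
        rcases i with _ | i
        · simpa [h0] using hk2
        · simpa using hm i (by omega)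
      · intro i hi
        rcases i with _ | i
        · exact ⟨k, by simpa using hk1, by simp [h0]⟩
        · simpa using hp i (by omega)

/-- parametrised circle -/
def circ (c1 c2 ρ θ : ℝ) : ℝ × ℝ := (c1 + ρ * Real.cos θ, c2 + ρ * Real.sin θ)

lemma circ_inj {c1 c2 ρ θ θ' : ℝ} (hρ : 0 < ρ) (h : circ c1 c2 ρ θ = circ c1 c2 ρ θ')
    (hlt : |θ - θ'| < 2 * Real.pi) : θ = θ' := by
  unfold circ at h
  simp only [Prod.mk.injEq, add_right_inj, mul_eq_mul_left_iff, hρ.ne', or_false] at h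
  have hc : Real.cos (θ - θ') = 1 := by
    rw [Real.cos_sub, h.1, h.2]; have := Real.sin_sq_add_cos_sq θ'; nlinarith
  obtain ⟨k, hk⟩ := (Real.cos_eq_one_iff _).1 hc
  have hpi := Real.pi_pos
  have : k = 0 := by
    rw [← hk, abs_mul, abs_of_pos (by positivity : (0:ℝ) < 2 * Real.pi)] at hlt
    have h3 : |(k : ℝ)| < 1 := by
      by_contra hcon
      push Not at hcon
      nlinarith
    have : |k| < 1 := by exact_mod_cast h3
    exact Int.abs_lt_one_iff.1 this
  subst this
  simp at hk
  linarith

/-- one monotone piece -/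
lemma piece_exists {c1 c2 ρ s t : ℝ} (hρ : 0 < ρ) (hst : s < t) (k : ℤ) (h1 : k * Real.pi ≤ s)
    (h2 : t ≤ (k + 1) * Real.pi) :
    ∃ (a b : ℝ) (g : ℝ → ℝ), a < b ∧ Continuous g ∧
      (((a, g a) = circ c1 c2 ρ s ∧ (b, g b) = circ c1 c2 ρ t) ∨
        ((a, g a) = circ c1 c2 ρ t ∧ (b, g b) = circ c1 c2 ρ s)) ∧
      (∀ x ∈ Icc a b, ∃ θ ∈ Icc s t, (x, g x) = circ c1 c2 ρ θ) ∧
      (∀ x ∈ Ioo a b, ∃ θ ∈ Ioo s t, (x, g x) = circ c1 c2 ρ θ) := by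
  -- reduce to the cosine on [0, π]
  set σ : ℝ := (-1) ^ k with hσ
  have hσ2 : σ = 1 ∨ σ = -1 := by
    rcases Int.even_or_odd k with h | h
    · left; rw [hσ]; exact h.neg_one_zpow
    · right; rw [hσ]; exact h.neg_one_zpow
  have hσs : σ * σ = 1 := by rcases hσ2 with h | h <;> rw [h] <;> norm_num
  set s' := s - k * Real.pi
  set t' := t - k * Real.pi
  have hs' : 0 ≤ s' := by simp only [s']; linarith
  have ht' : t' ≤ Real.pi := by simp only [t']; linarith
  have hst' : s' < t' := by simp only [s', t']; linarith
  have hcos : ∀ θ, Real.cos θ = σ * Real.cos (θ - k * Real.pi) := by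
    intro θ
    rw [Real.cos_sub_int_mul_pi, ← hσ, ← mul_assoc, hσs, one_mul]
  have hsin : ∀ θ, Real.sin θ = σ * Real.sin (θ - k * Real.pi) := by
    intro θ
    rw [Real.sin_sub_int_mul_pi, ← hσ, ← mul_assoc, hσs, one_mul]
  let g : ℝ → ℝ := fun x => c2 + ρ * σ * Real.sqrt (1 - ((x - c1) / ρ) ^ 2)
  have hgc : Continuous g := by fun_prop
  have hgv : ∀ τ, 0 ≤ τ → τ ≤ Real.pi → (c1 + ρ * (σ * Real.cos τ), g (c1 + ρ * (σ * Real.cos τ)))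
      = circ c1 c2 ρ (τ + k * Real.pi) := by
    intro τ h3 h4
    unfold circ
    rw [hcos (τ + k * Real.pi), hsin (τ + k * Real.pi), add_sub_cancel_right]
    simp only [g, Prod.mk.injEq, true_and]
    have : 1 - ((c1 + ρ * (σ * Real.cos τ) - c1) / ρ) ^ 2 = Real.sin τ ^ 2 := by
      have h5 := Real.sin_sq_add_cos_sq τ
      have : (c1 + ρ * (σ * Real.cos τ) - c1) / ρ = σ * Real.cos τ := by field_simp; ring
      rw [this]
      nlinarith
    rw [this, Real.sqrt_sq (Real.sin_nonneg_of_nonneg_of_le_pi h3 h4)]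
    ring
  have hcl : Real.cos t' < Real.cos s' := Real.cos_lt_cos_of_nonneg_of_le_pi hs' ht' hst'
  have hS : (c1 + ρ * (σ * Real.cos s'), g (c1 + ρ * (σ * Real.cos s'))) = circ c1 c2 ρ s := by
    rw [hgv s' hs' (hst'.le.trans ht')]; simp [s']
  have hT : (c1 + ρ * (σ * Real.cos t'), g (c1 + ρ * (σ * Real.cos t'))) = circ c1 c2 ρ t := by
    rw [hgv t' (hs'.trans hst'.le) ht']; simp [t']
  have ivtc : ∀ z ∈ Icc (Real.cos t') (Real.cos s'), ∃ τ ∈ Icc s' t', Real.cos τ = z := by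
    intro z hz
    exact intermediate_value_Icc' hst'.le Real.continuous_cos.continuousOn hz
  have ivto : ∀ z ∈ Ioo (Real.cos t') (Real.cos s'), ∃ τ ∈ Ioo s' t', Real.cos τ = z := by
    intro z hz
    exact intermediate_value_Ioo' hst'.le Real.continuous_cos.continuousOn hz
  have fin : ∀ x τ, 0 ≤ τ → τ ≤ Real.pi → Real.cos τ = σ * ((x - c1) / ρ) →
      (x, g x) = circ c1 c2 ρ (τ + k * Real.pi) := by
    intro x τ h3 h4 h5
    have : x = c1 + ρ * (σ * Real.cos τ) := by
      rw [h5, ← mul_assoc σ, hσs, one_mul]; field_simp; ring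
    rw [this]; exact hgv τ h3 h4
  have main : ∀ a b : ℝ, (∀ x ∈ Icc a b, σ * ((x - c1) / ρ) ∈ Icc (Real.cos t') (Real.cos s')) →
      (∀ x ∈ Ioo a b, σ * ((x - c1) / ρ) ∈ Ioo (Real.cos t') (Real.cos s')) →
      (∀ x ∈ Icc a b, ∃ θ ∈ Icc s t, (x, g x) = circ c1 c2 ρ θ) ∧
      (∀ x ∈ Ioo a b, ∃ θ ∈ Ioo s t, (x, g x) = circ c1 c2 ρ θ) := by
    intro a b hc ho
    constructor
    · intro x hx
      obtain ⟨τ, hτ, h5⟩ := ivtc _ (hc x hx)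
      refine ⟨τ + k * Real.pi, ?_, fin x τ (hs'.trans hτ.1) (hτ.2.trans ht') h5⟩
      simp only [s', t', mem_Icc] at hτ ⊢
      constructor <;> linarith [hτ.1, hτ.2]
    · intro x hx
      obtain ⟨τ, hτ, h5⟩ := ivto _ (ho x hx)
      refine ⟨τ + k * Real.pi, ?_, fin x τ (hs'.trans hτ.1.le) (hτ.2.le.trans ht') h5⟩
      simp only [s', t', mem_Ioo] at hτ ⊢
      constructor <;> linarith [hτ.1, hτ.2]
  rcases hσ2 with h | h
  · refine ⟨c1 + ρ * (σ * Real.cos t'), c1 + ρ * (σ * Real.cos s'), g, ?_, hgc, Or.inr ⟨hT, hS⟩,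
      main _ _ ?_ ?_⟩
    · rw [h]; nlinarith
    · rintro x ⟨h6, h7⟩
      rw [h] at h6 h7 ⊢
      simp only [one_mul] at h6 h7 ⊢
      rw [mem_Icc, le_div_iff₀ hρ, div_le_iff₀ hρ]
      constructor <;> linarith
    · rintro x ⟨h6, h7⟩
      rw [h] at h6 h7 ⊢
      simp only [one_mul] at h6 h7 ⊢
      rw [mem_Ioo, lt_div_iff₀ hρ, div_lt_iff₀ hρ]
      constructor <;> linarith
  · refine ⟨c1 + ρ * (σ * Real.cos s'), c1 + ρ * (σ * Real.cos t'), g, ?_, hgc, Or.inl ⟨hS, hT⟩,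
      main _ _ ?_ ?_⟩
    · rw [h]; nlinarith
    · rintro x ⟨h6, h7⟩
      rw [h] at h6 h7 ⊢
      rw [neg_one_mul, ← neg_div, mem_Icc, le_div_iff₀ hρ, div_le_iff₀ hρ]
      constructor <;> linarith
    · rintro x ⟨h6, h7⟩
      rw [h] at h6 h7 ⊢
      rw [neg_one_mul, ← neg_div, mem_Ioo, lt_div_iff₀ hρ, div_lt_iff₀ hρ]
      constructor <;> linarith

lemma chain_of_angles {A : Set (ℝ × ℝ)} {u v : ℝ × ℝ} {c1 c2 ρ α β : ℝ} (hρ : 0 < ρ)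
    (h1 : α < β) (h2 : β < α + 2 * Real.pi) (hA : ∀ θ ∈ Icc α β, circ c1 c2 ρ θ ∈ A)
    (hends : (circ c1 c2 ρ α = u ∧ circ c1 c2 ρ β = v) ∨ (circ c1 c2 ρ α = v ∧ circ c1 c2 ρ β = u)) :
    Nonempty (Chain A u v) := by
  have hpi := Real.pi_pos
  obtain ⟨n, t, hn, t0, tn, tm, tk⟩ := partition_exists 2 α β h1 (by
    have : α < (⌊α / Real.pi⌋ + 1) * Real.pi := by
      rw [← div_lt_iff₀ hpi]; exact Int.lt_floor_add_one _
    push_cast; linarith)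
  have tmono : ∀ j, j ≤ n → ∀ i, i < j → t i < t j := by
    intro j
    induction j with
    | zero => intro _ i hi; omega
    | succ j ih =>
      intro hj i hi
      rcases Nat.lt_succ_iff_lt_or_eq.1 hi with h | h
      · exact (ih (by omega) i h).trans (tm j (by omega))
      · subst h; exact tm i (by omega)
  have tle : ∀ i j, i ≤ j → j ≤ n → t i ≤ t j := by
    intro i j h hj
    rcases h.lt_or_eq with h | h
    · exact (tmono j hj i h).le
    · rw [h]
  have tI : ∀ i ≤ n, t i ∈ Icc α β := fun i hi =>
    ⟨t0 ▸ tle 0 i (Nat.zero_le _) hi, tn ▸ tle i n hi le_rfl⟩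
  have cinj : ∀ θ ∈ Icc α β, ∀ θ' ∈ Icc α β, circ c1 c2 ρ θ = circ c1 c2 ρ θ' → θ = θ' := by
    intro θ hθ θ' hθ' h
    apply circ_inj hρ h
    rw [abs_lt]; constructor <;> linarith [hθ.1, hθ.2, hθ'.1, hθ'.2]
  have ex : ∀ i, ∃ (a b : ℝ) (g : ℝ → ℝ), Continuous g ∧ (i < n → a < b ∧
      (((a, g a) = circ c1 c2 ρ (t i) ∧ (b, g b) = circ c1 c2 ρ (t (i + 1))) ∨
        ((a, g a) = circ c1 c2 ρ (t (i + 1)) ∧ (b, g b) = circ c1 c2 ρ (t i))) ∧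
      (∀ x ∈ Icc a b, ∃ θ ∈ Icc (t i) (t (i + 1)), (x, g x) = circ c1 c2 ρ θ) ∧
      (∀ x ∈ Ioo a b, ∃ θ ∈ Ioo (t i) (t (i + 1)), (x, g x) = circ c1 c2 ρ θ)) := by
    intro i
    by_cases hi : i < n
    · obtain ⟨k, hk1, hk2⟩ := tk i hi
      obtain ⟨a, b, g, p1, p2, p3⟩ := piece_exists (c1 := c1) (c2 := c2) hρ (tm i hi) k hk1 hk2
      exact ⟨a, b, g, p2, fun _ => ⟨p1, p3⟩⟩
    · exact ⟨0, 0, fun _ => 0, continuous_const, fun h => absurd h hi⟩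
  choose a b g hg hprop using ex
  have sub : ∀ i < n, ∀ θ ∈ Icc (t i) (t (i + 1)), θ ∈ Icc α β := fun i hi θ hθ =>
    ⟨(tI i hi.le).1.trans hθ.1, hθ.2.trans (tI (i + 1) hi).2⟩
  refine ⟨⟨n, fun i => circ c1 c2 ρ (t i), a, b, g, hn, ?_, ?_, fun i hi => (hprop i hi).1, hg,
    fun i hi => (hprop i hi).2.1, ?_, ?_, ?_⟩⟩
  · simpa only [t0, tn] using hends
  · intro i j hi hj h
    have := cinj _ (tI i hi) _ (tI j hj) h
    by_contra hne
    rcases lt_or_gt_of_ne hne with h' | h'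
    · exact (tmono j hj i h').ne this
    · exact (tmono i hi j h').ne' this
  · intro i hi x hx
    obtain ⟨θ, hθ, h⟩ := (hprop i hi).2.2.1 x hx
    rw [h]; exact hA θ (sub i hi θ hθ)
  · intro i hi j hj hij x hx hx' heq
    obtain ⟨θ, hθ, h⟩ := (hprop i hi).2.2.2 x hx
    obtain ⟨θ', hθ', h'⟩ := (hprop j hj).2.2.1 x hx'
    rw [heq, h'] at h
    have := cinj _ (sub j hj _ hθ') _ (sub i hi _ (Ioo_subset_Icc_self hθ)) h
    rcases lt_or_gt_of_ne hij with h3 | h3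
    · have := tle (i + 1) j h3 hj.le
      linarith [hθ.2, hθ'.1]
    · have := tle (j + 1) i h3 hi.le
      linarith [hθ.1, hθ'.2]
  · intro i hi x hx k hk heq
    obtain ⟨θ, hθ, h⟩ := (hprop i hi).2.2.2 x hx
    rw [h] at heq
    have := cinj _ (sub i hi _ (Ioo_subset_Icc_self hθ)) _ (tI k hk) heq
    rcases Nat.lt_or_ge i k with h3 | h3
    · have := tle (i + 1) k h3 hk
      linarith [hθ.2]
    · have := tle k i h3 hi.le
      linarith [hθ.1]

lemma chain_exists {A : Set (ℝ × ℝ)} (hA : IsPreconnected A) {c1 c2 ρ : ℝ} (hρ : 0 < ρ)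
    (hsub : ∀ z ∈ A, (z.1 - c1) ^ 2 + (z.2 - c2) ^ 2 = ρ ^ 2) {u v : ℝ × ℝ} (hu : u ∈ A)
    (hv : v ∈ A) (huv : u ≠ v) : Nonempty (Chain A u v) := by
  have hpi := Real.pi_pos
  -- the angle function with cut at `κ + π`
  let w : ℝ → ℝ × ℝ → ℂ := fun κ z =>
    (((z.1 - c1) / ρ : ℝ) + ((z.2 - c2) / ρ : ℝ) * Complex.I) * Complex.exp (-(κ : ℂ) * Complex.I)
  let τ : ℝ → ℝ × ℝ → ℝ := fun κ z => Complex.arg (w κ z) + κ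
  have hnorm : ∀ κ z, (z.1 - c1) ^ 2 + (z.2 - c2) ^ 2 = ρ ^ 2 → ‖w κ z‖ = 1 := by
    intro κ z hz
    simp only [w]
    rw [norm_mul]
    have e1 : ‖Complex.exp (-(κ : ℂ) * Complex.I)‖ = 1 := by
      have := Complex.norm_exp_ofReal_mul_I (-κ)
      simpa using this
    rw [e1, mul_one, Complex.norm_add_mul_I, Real.sqrt_eq_one]
    field_simp
    exact hz
  have hback : ∀ (κ : ℝ) (z : ℝ × ℝ) (θ : ℝ), (z.1 - c1) ^ 2 + (z.2 - c2) ^ 2 = ρ ^ 2 →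
      w κ z = Complex.exp (θ * Complex.I) → circ c1 c2 ρ (θ + κ) = z := by
    intro κ z θ hz h
    simp only [w] at h
    have h2 : (((z.1 - c1) / ρ : ℝ) + ((z.2 - c2) / ρ : ℝ) * Complex.I : ℂ)
        = Complex.exp ((θ + κ : ℝ) * Complex.I) := by
      have h3 : Complex.exp (-(κ : ℂ) * Complex.I) * Complex.exp ((κ : ℂ) * Complex.I) = 1 := by
        rw [← Complex.exp_add]; simp
      calc _ = ((((z.1 - c1) / ρ : ℝ) + ((z.2 - c2) / ρ : ℝ) * Complex.I : ℂ)
            * Complex.exp (-(κ : ℂ) * Complex.I)) * Complex.exp ((κ : ℂ) * Complex.I) := by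
              rw [mul_assoc, h3, mul_one]
        _ = _ := by rw [h, ← Complex.exp_add]; push_cast; ring_nf
    have hre := congrArg Complex.re h2
    have him := congrArg Complex.im h2
    rw [Complex.exp_ofReal_mul_I_re] at hre
    rw [Complex.exp_ofReal_mul_I_im] at him
    simp at hre him
    unfold circ
    ext
    · simp only; rw [← hre]; field_simp; ring
    · simp only; rw [← him]; field_simp; ring
  have hcirc : ∀ κ z, (z.1 - c1) ^ 2 + (z.2 - c2) ^ 2 = ρ ^ 2 → circ c1 c2 ρ (τ κ z) = z := by
    intro κ z hz
    apply hback κ z _ hz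
    have := Complex.norm_mul_exp_arg_mul_I (w κ z)
    rw [hnorm κ z hz] at this
    simpa using this.symm
  have harg : ∀ κ z, τ κ z ∈ Ioc (-Real.pi + κ) (Real.pi + κ) := by
    intro κ z
    have h1 := Complex.neg_pi_lt_arg (w κ z)
    have h2 := Complex.arg_le_pi (w κ z)
    exact ⟨by simp only [τ]; linarith, by simp only [τ]; linarith⟩
  -- it suffices to have angle function
  suffices H : ∃ κ : ℝ, ∀ x ∈ A, ∀ y ∈ A, ∀ θ ∈ Icc (τ κ x) (τ κ y), circ c1 c2 ρ θ ∈ A by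
    obtain ⟨κ, H⟩ := H
    have hcu := hcirc κ u (hsub u hu)
    have hcv := hcirc κ v (hsub v hv)
    have hne : τ κ u ≠ τ κ v := by
      intro h; rw [h] at hcu; exact huv (hcu.symm.trans hcv)
    have i1 := harg κ u
    have i2 := harg κ v
    rcases lt_or_gt_of_ne hne with h | h
    · exact chain_of_angles hρ h (by linarith [i1.1, i2.2]) (H u hu v hv) (Or.inl ⟨hcu, hcv⟩)
    · exact chain_of_angles hρ h (by linarith [i2.1, i1.2]) (H v hv u hu) (Or.inr ⟨hcv, hcu⟩)
  by_cases hfull : ∀ θ, circ c1 c2 ρ θ ∈ A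
  · exact ⟨0, fun _ _ _ _ θ _ => hfull θ⟩
  · push Not at hfull
    obtain ⟨θ0, h0⟩ := hfull
    refine ⟨θ0 - Real.pi, ?_⟩
    set κ := θ0 - Real.pi with hκ
    have hcont : ContinuousOn (τ κ) A := by
      intro z hz
      apply ContinuousAt.continuousWithinAt
      have hwc : ContinuousAt (w κ) z := by
        simp only [w]; fun_prop
      refine ContinuousAt.add ?_ continuousAt_const
      refine ContinuousAt.comp (f := w κ) (g := Complex.arg) ?_ hwc
      apply Complex.continuousAt_arg
      rw [Complex.mem_slitPlane_iff_arg]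
      have hn := hnorm κ z (hsub z hz)
      refine ⟨?_, fun h => by rw [h] at hn; simp at hn⟩
      intro hpi'
      have h1 := hcirc κ z (hsub z hz)
      simp only [τ] at h1
      rw [hpi', hκ, add_sub_cancel] at h1
      exact h0 (h1 ▸ hz)
    have himg := (hA.image _ hcont).ordConnected
    intro x hx y hy θ hθ
    obtain ⟨z, hz, rfl⟩ := himg.out (mem_image_of_mem _ hx) (mem_image_of_mem _ hy) hθ
    rw [hcirc κ z (hsub z hz)]; exact hz

/-- Existence of the algebraic dual for noncrossing connected subsets of circles in the plane. -/
theorem circle_dual {ε : Type} [Fintype ε] (A : ε → Set (ℝ × ℝ)) (u v : ε → ℝ × ℝ)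
    (hch : ∀ e, Nonempty (Chain (A e) (u e) (v e)))
    (hcross : ∀ e e', e ≠ e' → A e ∩ A e' ⊆ {u e, v e}) :
    ∃ (Φ : Type) (L R : ε → Φ),
      (∀ F P, ∑ e, (ind (u e = P) + ind (v e = P)) * (ind (L e = F) + ind (R e = F)) = 0) ∧
      (∀ c : ε → ZMod 2, (∀ P, ∑ e, (ind (u e = P) + ind (v e = P)) * c e = 0) →
        ∃ f : Φ → ZMod 2, ∀ e, f (L e) + f (R e) = c e) := by
  classical
  let K : ∀ e, Chain (A e) (u e) (v e) := fun e => (hch e).some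
  let ε' := (e : ε) × Fin (K e).n
  let a : ε' → ℝ := fun x => (K x.1).a x.2
  let b : ε' → ℝ := fun x => (K x.1).b x.2
  let g : ε' → ℝ → ℝ := fun x => (K x.1).g x.2
  -- points of the chain lie in `A`
  have hPA : ∀ e, ∀ k ≤ (K e).n, (K e).P k ∈ A e := by
    intro e k hk
    have hnp := (K e).npos
    have key : ∀ i < (K e).n, (K e).P i ∈ A e ∧ (K e).P (i + 1) ∈ A e := by
      intro i hi
      have hlt := (K e).lt i hi
      have m1 := (K e).mem i hi _ (left_mem_Icc.2 hlt.le)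
      have m2 := (K e).mem i hi _ (right_mem_Icc.2 hlt.le)
      rcases (K e).side i hi with ⟨h1, h2⟩ | ⟨h1, h2⟩
      · exact ⟨h1 ▸ m1, h2 ▸ m2⟩
      · exact ⟨h2 ▸ m2, h1 ▸ m1⟩
    rcases hk.lt_or_eq with h | h
    · exact (key k h).1
    · have := (key (k - 1) (by omega)).2
      rwa [Nat.sub_add_cancel (by omega)] at this
  have huvP : ∀ e z, z ∈ ({u e, v e} : Set (ℝ × ℝ)) → z = (K e).P 0 ∨ z = (K e).P (K e).n := by
    intro e z hz
    rcases (K e).ends with ⟨h1, h2⟩ | ⟨h1, h2⟩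
    · rcases hz with rfl | hz
      · exact Or.inl h1.symm
      · exact Or.inr ((mem_singleton_iff.1 hz).trans h2.symm)
    · rcases hz with rfl | hz
      · exact Or.inr h2.symm
      · exact Or.inl ((mem_singleton_iff.1 hz).trans h1.symm)
  have hN : NonCross a b g := by
    rintro ⟨e, i⟩ ⟨e', i'⟩ hne x h1 h2 h3 h4 heq
    simp only [a, b, g] at h1 h2 h3 h4 heq
    by_cases hee : e = e'
    · subst hee
      have hii : (i : ℕ) ≠ i' := by
        intro h; apply hne; rw [Fin.ext h]
      exact (K e).disj i i.2 i' i'.2 hii x ⟨h1, h2⟩ ⟨h3, h4⟩ heq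
    · have m1 := (K e).mem i i.2 x ⟨h1.le, h2.le⟩
      have m2 := (K e').mem i' i'.2 x ⟨h3, h4⟩
      rw [← heq] at m2
      rcases huvP e _ (hcross e e' hee ⟨m1, m2⟩) with h | h
      · exact (K e).notP i i.2 x ⟨h1, h2⟩ 0 (Nat.zero_le _) h
      · exact (K e).notP i i.2 x ⟨h1, h2⟩ _ le_rfl h
  obtain ⟨Φ, L, R, hii, hiii⟩ := plane_dual a b g (fun x => (K x.1).lt x.2 x.2.2)
    (fun x => (K x.1).cont x.2) hN
  -- incidences along a chain
  have hinc : ∀ e (i : Fin (K e).n) (P : ℝ × ℝ), inc a b g P.1 P.2 ⟨e, i⟩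
      = ind ((K e).P i = P) + ind ((K e).P (i + 1) = P) := by
    intro e i P
    unfold inc
    simp only [a, b, g]
    rcases (K e).side i i.2 with ⟨h1, h2⟩ | ⟨h1, h2⟩
    · rw [h1, h2]
    · rw [h1, h2, add_comm]
  have htel : ∀ e (P : ℝ × ℝ), ∑ i : Fin (K e).n, (ind ((K e).P i = P) + ind ((K e).P (i + 1) = P))
      = ind (u e = P) + ind (v e = P) := by
    intro e P
    have : ∀ n : ℕ, ∑ i : Fin n, (ind ((K e).P i = P) + ind ((K e).P (i + 1) = P))
        = ind ((K e).P 0 = P) + ind ((K e).P n = P) := by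
      intro n
      induction n with
      | zero => simp [z2_add_self]
      | succ n ih =>
        rw [Fin.sum_univ_castSucc]
        simp only [Fin.val_castSucc, Fin.val_last]
        rw [ih]
        have := z2_add_self (ind ((K e).P n = P))
        linear_combination this
    rw [this]
    rcases (K e).ends with ⟨h1, h2⟩ | ⟨h1, h2⟩
    · rw [h1, h2]
    · rw [h1, h2, add_comm]
  let i0 : ∀ e, Fin (K e).n := fun e => ⟨0, (K e).npos⟩
  have hsig : ∀ (c : ε → ZMod 2) (P : ℝ × ℝ),
      ∑ x : ε', inc a b g P.1 P.2 x * c x.1 = ∑ e, (ind (u e = P) + ind (v e = P)) * c e := by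
    intro c P
    rw [Fintype.sum_sigma]
    apply Finset.sum_congr rfl
    intro e _
    change ∑ y : Fin (K e).n, inc a b g P.1 P.2 ⟨e, y⟩ * c e = _
    rw [← Finset.sum_mul]
    congr 1
    rw [← htel e P]
    exact Finset.sum_congr rfl (fun i _ => hinc e i P)
  refine ⟨Φ, fun e => L ⟨e, i0 e⟩, fun e => R ⟨e, i0 e⟩, ?_, ?_⟩
  · intro F P
    let X : ε' → ZMod 2 := fun x => ind (L x = F) + ind (R x = F)
    have hstep : ∀ e (k : ℕ) (hk : k + 1 < (K e).n),
        X ⟨e, ⟨k + 1, hk⟩⟩ = X ⟨e, ⟨k, by omega⟩⟩ := by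
      intro e k hk
      have h := hii F ((K e).P (k + 1)).1 ((K e).P (k + 1)).2
      have hne : (⟨e, ⟨k, by omega⟩⟩ : ε') ≠ ⟨e, ⟨k + 1, hk⟩⟩ := by
        intro h; simp at h
      rw [Fintype.sum_eq_add _ _ hne] at h
      · rw [hinc e ⟨k, _⟩ ((K e).P (k + 1)), hinc e ⟨k + 1, hk⟩ ((K e).P (k + 1))] at h
        simp only at h
        rw [ind_true (P := True) trivial,
          ind_false (P := (K e).P k = (K e).P (k + 1))
            (fun h' => by have := (K e).inj _ _ (by omega) (by omega) h'; omega),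
          ind_false (P := (K e).P (k + 1 + 1) = (K e).P (k + 1))
            (fun h' => by have := (K e).inj _ _ (by omega) (by omega) h'; omega)] at h
        change (0 + 1) * X _ + (1 + 0) * X _ = 0 at h
        have h2 := z2_add_self (X ⟨e, ⟨k, by omega⟩⟩)
        linear_combination h - h2
      · rintro ⟨e', i⟩ ⟨hx1, hx2⟩
        rw [hinc e' i ((K e).P (k + 1))]
        have hno : ∀ l ≤ (K e').n, (e' = e → l ≠ k + 1) → (K e').P l ≠ (K e).P (k + 1) := by
          intro l hl hl2 heq
          by_cases hee : e' = e
          · subst hee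
            exact hl2 rfl ((K e').inj _ _ hl (by omega) heq)
          · have m1 := hPA e' l hl
            have m2 := hPA e (k + 1) hk.le
            rw [heq] at m1
            rcases huvP e _ (hcross e e' (Ne.symm hee) ⟨m2, m1⟩) with h | h
            · have := (K e).inj _ _ hk.le (Nat.zero_le _) h; omega
            · have := (K e).inj _ _ hk.le le_rfl h; omega
        rw [ind_false (hno i i.2.le ?_), ind_false (hno (i + 1) i.2 ?_), add_zero, zero_mul]
        · rintro rfl h; apply hx1
          have : i = ⟨k, by omega⟩ := Fin.ext (by simpa using h)
          rw [this]
        · rintro rfl h; apply hx2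
          have : i = ⟨k + 1, hk⟩ := Fin.ext h
          rw [this]
    have hX : ∀ x : ε', X x = X ⟨x.1, i0 x.1⟩ := by
      rintro ⟨e, ⟨k, hk⟩⟩
      induction k with
      | zero => rfl
      | succ k ih => rw [hstep e k hk]; exact ih (by omega)
    rw [← hsig (fun e => X ⟨e, i0 e⟩) P, ← hii F P.1 P.2]
    apply Finset.sum_congr rfl
    intro x _
    congr 1
    exact (hX x).symm
  · intro c hc
    obtain ⟨f, hf⟩ := hiii (fun x => c x.1) (fun x y => (hsig c (x, y)).trans (hc (x, y)))
    exact ⟨f, fun e => hf ⟨e, i0 e⟩⟩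

end SphereCover

namespace SphereCover

lemma exists_unit_off_planes {ι : Type} [Finite ι] (n : ι → EuclideanSpace ℝ (Fin 3)) (k : ι → ℝ)
    (hn : ∀ e, n e ≠ 0) {R : ℝ} (hR : 0 < R) :
    ∃ m : EuclideanSpace ℝ (Fin 3), ‖m‖ = 1 ∧ ∀ e, k e + R * inner ℝ (n e) m ≠ 0 := by
  let f : ι → Polynomial ℝ := fun e =>
    Polynomial.C (k e + R * n e 2) * Polynomial.X ^ 4 +
    Polynomial.C (k e + 2 * R * n e 1 + R * n e 2) * Polynomial.X ^ 2 +
    Polynomial.C (2 * R * n e 0) * Polynomial.X + Polynomial.C (k e - R * n e 2)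
  have hf : ∀ e, f e ≠ 0 := by
    intro e he
    have h0 := congrArg (Polynomial.eval 0) he
    have h1 := congrArg (Polynomial.eval 1) he
    have h2 := congrArg (Polynomial.eval (-1)) he
    have h3 := congrArg (Polynomial.eval 2) he
    simp [f] at h0 h1 h2 h3
    ring_nf at h0 h1 h2 h3
    have z0' : R * n e 0 = 0 := by linarith
    have z2 : R * n e 2 = 0 := by linarith
    have z1 : R * n e 1 = 0 := by linarith
    have z0 : n e 0 = 0 := by simpa [hR.ne'] using z0'
    have z2' : n e 2 = 0 := by simpa [hR.ne'] using z2
    have z1' : n e 1 = 0 := by simpa [hR.ne'] using z1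
    apply hn e
    ext i
    fin_cases i <;> simp [z0, z1', z2']
  have hfin : (⋃ e, {t : ℝ | (f e).IsRoot t}).Finite := by
    apply Set.finite_iUnion
    intro e
    exact Polynomial.finite_setOfPred_isRoot (hf e)
  obtain ⟨t, ht⟩ := hfin.exists_notMem
  simp only [mem_iUnion, mem_ofPred_eq, not_exists] at ht
  have hs : (0 : ℝ) < t ^ 4 + t ^ 2 + 1 := by positivity
  refine ⟨!₂[2 * t / (t ^ 4 + t ^ 2 + 1), 2 * t ^ 2 / (t ^ 4 + t ^ 2 + 1),
    (t ^ 4 + t ^ 2 - 1) / (t ^ 4 + t ^ 2 + 1)], ?_, ?_⟩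
  · rw [EuclideanSpace.norm_eq, Real.sqrt_eq_one]
    simp [Fin.sum_univ_three]
    field_simp
    ring
  · intro e h
    apply ht e
    simp [PiLp.inner_apply, Fin.sum_univ_three] at h
    simp [Polynomial.IsRoot, f]
    field_simp at h
    linear_combination h

/-- Stereographic projection of a sphere avoiding a finite family of planes. -/
lemma stereo {ι : Type} [Finite ι] (c : EuclideanSpace ℝ (Fin 3)) {R : ℝ} (hR : 0 < R)
    (n : ι → EuclideanSpace ℝ (Fin 3)) (d : ι → ℝ) (hn : ∀ e, n e ≠ 0) :
    ∃ (N : EuclideanSpace ℝ (Fin 3)) (π : EuclideanSpace ℝ (Fin 3) → ℝ × ℝ),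
      (∀ e, inner ℝ (n e) N ≠ d e) ∧
      ContinuousOn π {x | dist x c = R ∧ x ≠ N} ∧ InjOn π {x | dist x c = R ∧ x ≠ N} ∧
      ∀ e, ∃ c1 c2 κ : ℝ, ∀ x, dist x c = R → inner ℝ (n e) x = d e →
        ((π x).1 - c1) ^ 2 + ((π x).2 - c2) ^ 2 = κ := by
  obtain ⟨m, hm, hoff⟩ := exists_unit_off_planes n (fun e => inner ℝ (n e) c - d e) hn hR
  have hon : Orthonormal ℝ (({2} : Set (Fin 3)).domRestrict (fun _ => m)) := by
    constructor
    · intro i; exact hm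
    · intro i j hij
      exact absurd (Subsingleton.elim i j) hij
  obtain ⟨b, hb⟩ := hon.exists_orthonormalBasis_extension_of_card_eq (by simp)
  have hb2 : b 2 = m := hb 2 rfl
  let ξ : EuclideanSpace ℝ (Fin 3) → EuclideanSpace ℝ (Fin 3) := fun x => b.repr (R⁻¹ • (x - c))
  have hξc : Continuous ξ := by
    simp only [ξ]; fun_prop
  have hξi : Function.Injective ξ := by
    intro x y h
    have := b.repr.injective h
    simpa [hR.ne'] using this
  have hξn : ∀ x, dist x c = R → ξ x 0 ^ 2 + ξ x 1 ^ 2 + ξ x 2 ^ 2 = 1 := by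
    intro x hx
    have h1 : ‖ξ x‖ = 1 := by
      simp only [ξ, LinearIsometryEquiv.norm_map, norm_smul, norm_inv, Real.norm_eq_abs,
        abs_of_pos hR]
      rw [← dist_eq_norm, hx, inv_mul_cancel₀ hR.ne']
    have h2 := EuclideanSpace.norm_sq_eq (ξ x)
    rw [h1, Fin.sum_univ_three] at h2
    simp only [Real.norm_eq_abs, sq_abs] at h2
    linarith
  have hξm : ∀ x, ξ x 2 = 1 → dist x c = R → x = c + R • m := by
    intro x h hx
    have h1 := hξn x hx
    rw [h] at h1
    have h0 : ξ x 0 = 0 := by nlinarith [sq_nonneg (ξ x 0), sq_nonneg (ξ x 1)]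
    have h1 : ξ x 1 = 0 := by nlinarith [sq_nonneg (ξ x 0), sq_nonneg (ξ x 1)]
    apply hξi
    have : ξ (c + R • m) = b.repr (b 2) := by
      simp only [ξ, add_sub_cancel_left, smul_smul, inv_mul_cancel₀ hR.ne', one_smul, hb2]
    rw [this, b.repr_self]
    ext i
    fin_cases i
    · simpa using h0
    · simpa using h1
    · simpa using h
  have hinner : ∀ a x, inner ℝ a x = inner ℝ a c + R * (b.repr a 0 * ξ x 0 + b.repr a 1 * ξ x 1
      + b.repr a 2 * ξ x 2) := by
    intro a x
    have h1 : inner ℝ a (x - c) = R * inner ℝ (b.repr a) (ξ x) := by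
      simp only [ξ, LinearIsometryEquiv.inner_map_map, inner_smul_right]
      field_simp
    rw [inner_sub_right] at h1
    have h2 : inner ℝ (b.repr a) (ξ x) = b.repr a 0 * ξ x 0 + b.repr a 1 * ξ x 1
        + b.repr a 2 * ξ x 2 := by
      rw [PiLp.inner_apply, Fin.sum_univ_three]
      simp [mul_comm]
    rw [h2] at h1
    linarith
  refine ⟨c + R • m, fun x => (ξ x 0 / (1 - ξ x 2), ξ x 1 / (1 - ξ x 2)), ?_, ?_, ?_, ?_⟩
  · intro e h
    apply hoff e
    rw [inner_add_right, inner_smul_right] at h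
    linarith
  · have hc : ∀ i, Continuous fun x => ξ x i := fun i => by fun_prop
    have hne : ∀ x ∈ {x | dist x c = R ∧ x ≠ c + R • m}, 1 - ξ x 2 ≠ 0 := by
      rintro x ⟨h1, h2⟩ h
      exact h2 (hξm x (by linarith) h1)
    exact ContinuousOn.prodMk
      ((hc 0).continuousOn.div (continuous_const.sub (hc 2)).continuousOn hne)
      ((hc 1).continuousOn.div (continuous_const.sub (hc 2)).continuousOn hne)
  · rintro x ⟨hx1, hx2⟩ y ⟨hy1, hy2⟩ hxy
    have ex : 1 - ξ x 2 ≠ 0 := fun h => hx2 (hξm x (by linarith) hx1)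
    have ey : 1 - ξ y 2 ≠ 0 := fun h => hy2 (hξm y (by linarith) hy1)
    have nx := hξn x hx1
    have ny := hξn y hy1
    rw [Prod.mk.injEq] at hxy
    obtain ⟨e1, e2⟩ := hxy
    have qx : (ξ x 0 / (1 - ξ x 2)) ^ 2 + (ξ x 1 / (1 - ξ x 2)) ^ 2 = 2 / (1 - ξ x 2) - 1 := by
      field_simp; linear_combination nx
    have qy : (ξ y 0 / (1 - ξ y 2)) ^ 2 + (ξ y 1 / (1 - ξ y 2)) ^ 2 = 2 / (1 - ξ y 2) - 1 := by
      field_simp; linear_combination ny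
    rw [e1, e2, qy] at qx
    have e3 : 1 - ξ x 2 = 1 - ξ y 2 := by
      have : 2 / (1 - ξ y 2) = 2 / (1 - ξ x 2) := by linarith
      field_simp at this
      linarith
    rw [e3] at e1 e2
    apply hξi
    ext i
    fin_cases i
    · simpa [ey] using (div_left_inj' ey).1 e1
    · simpa [ey] using (div_left_inj' ey).1 e2
    · simp; linarith
  · intro e
    have h0 : (inner ℝ (n e) c - d e) + R * b.repr (n e) 2 ≠ 0 := by
      have := hoff e
      rwa [← hb2, real_inner_comm (b 2) (n e), ← b.repr_apply_apply] at this
    set k := inner ℝ (n e) c - d e with hk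
    set a0 := b.repr (n e) 0
    set a1 := b.repr (n e) 1
    set a2 := b.repr (n e) 2
    refine ⟨-(R * a0) / (k + R * a2), -(R * a1) / (k + R * a2),
      (R * a2 - k) / (k + R * a2) + (R * a0 / (k + R * a2)) ^ 2 + (R * a1 / (k + R * a2)) ^ 2,
      ?_⟩
    intro x hx hpl
    have nx := hξn x hx
    have hp : k + R * (a0 * ξ x 0 + a1 * ξ x 1 + a2 * ξ x 2) = 0 := by
      rw [hinner] at hpl; linarith
    have ex : 1 - ξ x 2 ≠ 0 := by
      intro h
      have h2 : ξ x 2 = 1 := by linarith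
      rw [h2] at nx hp
      have h0' : ξ x 0 = 0 := by nlinarith [sq_nonneg (ξ x 0), sq_nonneg (ξ x 1)]
      have h1' : ξ x 1 = 0 := by nlinarith [sq_nonneg (ξ x 0), sq_nonneg (ξ x 1)]
      rw [h0', h1'] at hp
      apply h0; linarith
    simp only
    have qx : (ξ x 0 / (1 - ξ x 2)) ^ 2 + (ξ x 1 / (1 - ξ x 2)) ^ 2 = 2 / (1 - ξ x 2) - 1 := by
      field_simp; linear_combination nx
    have hl : R * a0 * (ξ x 0 / (1 - ξ x 2)) + R * a1 * (ξ x 1 / (1 - ξ x 2))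
        = - (k + R * a2) / (1 - ξ x 2) + R * a2 := by
      field_simp; linear_combination hp
    have hl2 : R * a0 / (k + R * a2) * (ξ x 0 / (1 - ξ x 2)) + R * a1 / (k + R * a2) * (ξ x 1 / (1 - ξ x 2))
        = - 1 / (1 - ξ x 2) + R * a2 / (k + R * a2) := by
      have : (k + R * a2)⁻¹ * (k + R * a2) = 1 := inv_mul_cancel₀ h0
      linear_combination (k + R * a2)⁻¹ * hl - this / (1 - ξ x 2)
    have h5 : (R * a2 - k) / (k + R * a2) = 2 * (R * a2 / (k + R * a2)) - 1 := by
      field_simp; ring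
    rw [h5]
    linear_combination qx + 2 * hl2

end SphereCover

namespace SphereCover

lemma sphere_eq {S : Set (EuclideanSpace ℝ (Fin 3))} (h : IsSphereDim 3 2 S) :
    ∃ (c : EuclideanSpace ℝ (Fin 3)) (R : ℝ), 0 < R ∧ S = {x | dist x c = R} := by
  obtain ⟨P, c, r, hP, hc, hr, rfl⟩ := h
  refine ⟨c, r, hr, ?_⟩
  have h1 : P.direction = ⊤ := Submodule.eq_top_of_finrank_eq (by simpa using hP)
  have h2 : P = ⊤ := (AffineSubspace.direction_eq_top_iff_of_nonempty ⟨c, hc⟩).1 h1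
  subst h2
  ext x
  simp

lemma plane_normal {P : AffineSubspace ℝ (EuclideanSpace ℝ (Fin 3))}
    (hP : Module.finrank ℝ P.direction = 2) {c : EuclideanSpace ℝ (Fin 3)} (hc : c ∈ P) :
    ∃ n : EuclideanSpace ℝ (Fin 3), n ≠ 0 ∧ ∀ x ∈ P, inner ℝ n x = inner ℝ n c := by
  have h1 : P.direction ≠ ⊤ := by
    intro h; rw [h] at hP; simp at hP
  have h2 : P.directionᗮ ≠ ⊥ := by
    intro h; exact h1 (Submodule.orthogonal_eq_bot_iff.1 h)
  obtain ⟨n, hn, hn0⟩ := Submodule.exists_mem_ne_zero_of_ne_bot h2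
  refine ⟨n, hn0, fun x hx => ?_⟩
  have := (Submodule.mem_orthogonal' _ _).1 hn (x - c) (AffineSubspace.vsub_mem_direction hx hc)
  rw [inner_sub_right] at this
  linarith

lemma circle_subset_sphere {C : Set (EuclideanSpace ℝ (Fin 3))} (hC : IsCircle 3 C)
    {c' : EuclideanSpace ℝ (Fin 3)} {R : ℝ} (hR : 0 < R)
    (hinf : (C ∩ {x | dist x c' = R}).Infinite) : C ⊆ {x | dist x c' = R} := by
  obtain ⟨P, c, r, hP, hc, hr, rfl⟩ := hC
  obtain ⟨t, ht, htc⟩ := hinf.exists_subset_card_eq 3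
  obtain ⟨x1, x2, x3, h12, h13, h23, rfl⟩ := Finset.card_eq_three.1 htc
  have m1 := ht (show x1 ∈ _ by simp)
  have m2 := ht (show x2 ∈ _ by simp)
  have m3 := ht (show x3 ∈ _ by simp)
  have hcos : EuclideanGeometry.Cospherical ({x1, x2, x3} : Set (EuclideanSpace ℝ (Fin 3))) := by
    refine ⟨c, r, ?_⟩
    rintro x (rfl | rfl | rfl)
    · exact m1.1.2
    · exact m2.1.2
    · exact m3.1.2
  have hind := hcos.affineIndependent_of_ne h12 h13 h23
  have hspan := hind.affineSpan_eq_of_le_of_card_eq_finrank_add_one (sp := P)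
    (affineSpan_le.2 (by
      rintro _ ⟨i, rfl⟩
      fin_cases i
      · exact m1.1.1
      · exact m2.1.1
      · exact m3.1.1)) (by simp [hP])
  -- the difference of the squared distances is affine
  have hdiff : ∀ x, dist x c = r → dist x c' ^ 2 = r ^ 2 + 2 * inner ℝ (c - c') (x - c)
      + ‖c - c'‖ ^ 2 := by
    intro x hx
    rw [← hx, dist_eq_norm, dist_eq_norm, show x - c' = (x - c) + (c - c') by abel,
      norm_add_sq_real, real_inner_comm]
  have hval : ∀ x ∈ affineSpan ℝ (Set.range ![x1, x2, x3]),
      inner ℝ (c - c') (x - c) = (R ^ 2 - r ^ 2 - ‖c - c'‖ ^ 2) / 2 := by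
    intro x hx
    refine affineSpan_induction hx ?_ ?_
    · intro x hx
      obtain ⟨i, rfl⟩ := hx
      have key : ∀ x, dist x c = r → dist x c' = R →
          inner ℝ (c - c') (x - c) = (R ^ 2 - r ^ 2 - ‖c - c'‖ ^ 2) / 2 := by
        intro x h1 h2
        have := hdiff x h1
        rw [h2] at this
        linarith
      fin_cases i
      · exact key _ m1.1.2 m1.2
      · exact key _ m2.1.2 m2.2
      · exact key _ m3.1.2 m3.2
    · intro a u v w hu hv hw
      have : (a • (u -ᵥ v) +ᵥ w) - c = a • ((u - c) - (v - c)) + (w - c) := by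
        simp only [vsub_eq_sub, vadd_eq_add]
        rw [sub_sub_sub_cancel_right]
        abel
      rw [this, inner_add_right, inner_smul_right, inner_sub_right, hu, hv, hw]
      ring
  rintro x ⟨hx, hxr⟩
  have h1 := hdiff x hxr
  rw [hval x (hspan ▸ hx)] at h1
  have h2 : dist x c' ^ 2 = R ^ 2 := by rw [h1]; ring
  exact (pow_left_inj₀ dist_nonneg hR.le two_ne_zero).1 h2

lemma arc_subset_sphere {A : Set (EuclideanSpace ℝ (Fin 3))} (hA : IsArc 3 A)
    (hnt : A.Nontrivial) (𝒮 : Finset (Set (EuclideanSpace ℝ (Fin 3))))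
    (hS : ∀ S ∈ 𝒮, IsSphereDim 3 2 S) (hcov : A ⊆ ⋃ S ∈ 𝒮, S) : ∃ S ∈ 𝒮, A ⊆ S := by
  obtain ⟨C, hC, hAC, -, hconn⟩ := hA
  have hinf : A.Infinite := hconn.isPreconnected.infinite_of_nontrivial hnt
  have : ∃ S ∈ 𝒮, (A ∩ S).Infinite := by
    by_contra hno
    push Not at hno
    apply hinf
    have : A ⊆ ⋃ S ∈ 𝒮, A ∩ S := by
      intro x hx
      have := hcov hx
      simp only [mem_iUnion, exists_prop] at this ⊢
      obtain ⟨S, h1, h2⟩ := this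
      exact ⟨S, h1, hx, h2⟩
    refine Set.Finite.subset (Set.Finite.biUnion 𝒮.finite_toSet (fun S hS => ?_)) this
    simpa using hno S hS
  obtain ⟨S, hSm, hSi⟩ := this
  obtain ⟨c, R, hR, rfl⟩ := sphere_eq (hS S hSm)
  exact ⟨_, hSm, hAC.trans (circle_subset_sphere hC hR
    (hSi.mono (inter_subset_inter_left _ hAC)))⟩

end SphereCover

namespace SphereCover

lemma ind_inj {α β : Type} {f : α → β} {x y : α} {z : β} (hz : z = f y) (h : f x = f y → x = y) :
    ind (f x = z) = ind (x = y) := by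
  subst hz
  exact ind_congr ⟨h, fun h => by rw [h]⟩

lemma mem_edge {p q : ℕ} (i : Fin p) (j : Fin q) :
    s(Sum.inl i, Sum.inr j) ∈ (completeBipartiteGraph (Fin p) (Fin q)).edgeSet := by
  simp [completeBipartiteGraph]

lemma arc_nontrivial {p q : ℕ} (D : CircularArcDrawing 3 (completeBipartiteGraph (Fin p) (Fin q)))
    (i : Fin p) (j : Fin q) : (D.arc s(Sum.inl i, Sum.inr j)).Nontrivial := by
  refine ⟨_, D.endpoint_mem _ (mem_edge i j) (Sum.inl i) (by simp), _,
    D.endpoint_mem _ (mem_edge i j) (Sum.inr j) (by simp), ?_⟩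
  intro h
  have := D.inj h
  simp at this

theorem sphere_edges_bound {p q : ℕ} (hp : 1 ≤ p) (hpq : 3 ≤ p + q)
    (D : CircularArcDrawing 3 (completeBipartiteGraph (Fin p) (Fin q)))
    {S : Set (EuclideanSpace ℝ (Fin 3))} (hS : IsSphereDim 3 2 S) (ε : Type) [Fintype ε]
    (s : ε → Fin p) (t : ε → Fin q) (hinj : ∀ e e', s e = s e' → t e = t e' → e = e')
    (hsub : ∀ e, D.arc s(Sum.inl (s e), Sum.inr (t e)) ⊆ S) :
    Fintype.card ε + 4 ≤ 2 * (p + q) := by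
  obtain ⟨c, R, hR, rfl⟩ := sphere_eq hS
  let E : ε → Sym2 (Fin p ⊕ Fin q) := fun e => s(Sum.inl (s e), Sum.inr (t e))
  have hE : ∀ e, E e ∈ (completeBipartiteGraph (Fin p) (Fin q)).edgeSet := fun e => mem_edge _ _
  have hEinj : ∀ e e', E e = E e' → e = e' := by
    intro e e' h
    have h' : (s e = s e') ∧ (t e = t e') := by simpa [E] using h
    exact hinj e e' h'.1 h'.2
  have hpl : ∀ e, ∃ (n : EuclideanSpace ℝ (Fin 3)) (d : ℝ), n ≠ 0 ∧
      ∀ x ∈ D.arc (E e), inner ℝ n x = d := by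
    intro e
    obtain ⟨C, ⟨P, c0, r, hP, hc, hr, rfl⟩, hAC, -, -⟩ := D.arc_isArc _ (hE e)
    obtain ⟨n, hn, h⟩ := plane_normal hP hc
    exact ⟨n, _, hn, fun x hx => h x (hAC hx).1⟩
  choose n d hn hnd using hpl
  obtain ⟨N, π, hN, hcont, hπ, hcirc⟩ := stereo c hR n d hn
  have hdom : ∀ e, D.arc (E e) ⊆ {x | dist x c = R ∧ x ≠ N} := by
    intro e x hx
    refine ⟨hsub e hx, ?_⟩
    rintro rfl
    exact hN e (hnd e _ hx)
  have hu : ∀ e, D.pos (Sum.inl (s e)) ∈ D.arc (E e) := fun e =>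
    D.endpoint_mem _ (hE e) _ (by simp [E])
  have hv : ∀ e, D.pos (Sum.inr (t e)) ∈ D.arc (E e) := fun e =>
    D.endpoint_mem _ (hE e) _ (by simp [E])
  have hne : ∀ i j, D.pos (Sum.inl i) ≠ D.pos (Sum.inr j) := by
    intro i j h
    have := D.inj h
    simp at this
  let A : ε → Set (ℝ × ℝ) := fun e => π '' D.arc (E e)
  let u : ε → ℝ × ℝ := fun e => π (D.pos (Sum.inl (s e)))
  let v : ε → ℝ × ℝ := fun e => π (D.pos (Sum.inr (t e)))
  have hch : ∀ e, Nonempty (Chain (A e) (u e) (v e)) := by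
    intro e
    obtain ⟨c1, c2, κ, h⟩ := hcirc e
    have huv : u e ≠ v e := fun h => hne _ _ (hπ (hdom e (hu e)) (hdom e (hv e)) h)
    have hall : ∀ z ∈ A e, (z.1 - c1) ^ 2 + (z.2 - c2) ^ 2 = κ := by
      rintro _ ⟨x, hx, rfl⟩
      exact h x (hsub e hx) (hnd e x hx)
    have huA : u e ∈ A e := mem_image_of_mem _ (hu e)
    have hvA : v e ∈ A e := mem_image_of_mem _ (hv e)
    have hκ : 0 < κ := by
      have h1 := hall _ huA
      have h2 := hall _ hvA
      by_contra hle
      apply huv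
      have a1 : (u e).1 - c1 = 0 := by
        nlinarith [sq_nonneg ((u e).1 - c1), sq_nonneg ((u e).2 - c2)]
      have a2 : (u e).2 - c2 = 0 := by
        nlinarith [sq_nonneg ((u e).1 - c1), sq_nonneg ((u e).2 - c2)]
      have b1 : (v e).1 - c1 = 0 := by
        nlinarith [sq_nonneg ((v e).1 - c1), sq_nonneg ((v e).2 - c2)]
      have b2 : (v e).2 - c2 = 0 := by
        nlinarith [sq_nonneg ((v e).1 - c1), sq_nonneg ((v e).2 - c2)]
      exact Prod.ext (by linarith) (by linarith)
    have hconn : IsPreconnected (A e) := by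
      obtain ⟨_, _, _, _, hc⟩ := D.arc_isArc _ (hE e)
      exact hc.isPreconnected.image _ (hcont.mono (hdom e))
    refine chain_exists hconn (c1 := c1) (c2 := c2) (Real.sqrt_pos.2 hκ) ?_ huA hvA huv
    rw [Real.sq_sqrt hκ.le]
    exact hall
  have hcross : ∀ e e', e ≠ e' → A e ∩ A e' ⊆ {u e, v e} := by
    rintro e e' hee _ ⟨⟨x, hx, rfl⟩, ⟨y, hy, hxy⟩⟩
    have hxy' : y = x := hπ (hdom e' hy) (hdom e hx) hxy
    subst hxy'
    have hmem : y ∈ D.arc (E e) ∩ D.arc (E e') := ⟨hx, hy⟩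
    rw [D.crossFree _ (hE e) _ (hE e') (fun h => hee (hEinj _ _ h))] at hmem
    obtain ⟨w, ⟨hw, -⟩, rfl⟩ := hmem
    simp only [E, Sym2.mem_iff] at hw
    rcases hw with rfl | rfl
    · exact Or.inl rfl
    · exact Or.inr rfl
  obtain ⟨Φ, L, Rr, h2, h3⟩ := circle_dual A u v hch hcross
  -- translate incidences
  have hS1 : ∀ e0 e, ind (u e = u e0) + ind (v e = u e0) = ind (s e = s e0) := by
    intro e0 e
    rw [ind_false (P := v e = u e0), add_zero]
    · apply ind_congr
      constructor
      · intro h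
        have := D.inj (hπ (hdom e (hu e)) (hdom e0 (hu e0)) h)
        simpa using this
      · intro h; simp only [u, h]
    · intro h
      exact hne _ _ (hπ (hdom e (hv e)) (hdom e0 (hu e0)) h).symm
  have hS2 : ∀ e0 e, ind (u e = v e0) + ind (v e = v e0) = ind (t e = t e0) := by
    intro e0 e
    rw [ind_false (P := u e = v e0), zero_add]
    · apply ind_congr
      constructor
      · intro h
        have := D.inj (hπ (hdom e (hv e)) (hdom e0 (hv e0)) h)
        simpa using this
      · intro h; simp only [v, h]
    · intro h
      exact hne _ _ (hπ (hdom e (hu e)) (hdom e0 (hv e0)) h)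
  refine comb_bound hp hpq s t hinj L Rr ?_ ?_ ?_
  · intro F i
    by_cases hi : ∃ e0, s e0 = i
    · obtain ⟨e0, rfl⟩ := hi
      rw [← h2 F (u e0)]
      exact Finset.sum_congr rfl (fun e _ => by rw [hS1])
    · push Not at hi
      exact Finset.sum_eq_zero (fun e _ => by rw [ind_false (hi e), zero_mul])
  · intro F j
    by_cases hj : ∃ e0, t e0 = j
    · obtain ⟨e0, rfl⟩ := hj
      rw [← h2 F (v e0)]
      exact Finset.sum_congr rfl (fun e _ => by rw [hS2])
    · push Not at hj
      exact Finset.sum_eq_zero (fun e _ => by rw [ind_false (hj e), zero_mul])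
  · intro cc hc1 hc2
    apply h3
    intro P
    by_cases hP1 : ∃ e0, u e0 = P
    · obtain ⟨e0, rfl⟩ := hP1
      rw [← hc1 (s e0)]
      exact Finset.sum_congr rfl (fun e _ => by rw [hS1])
    · by_cases hP2 : ∃ e0, v e0 = P
      · obtain ⟨e0, rfl⟩ := hP2
        rw [← hc2 (t e0)]
        exact Finset.sum_congr rfl (fun e _ => by rw [hS2])
      · push Not at hP1 hP2
        exact Finset.sum_eq_zero (fun e _ => by
          rw [ind_false (hP1 e), ind_false (hP2 e), add_zero, zero_mul])

theorem lower_mul {p q : ℕ} (hp : 1 ≤ p) (hpq : 3 ≤ p + q)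
    (D : CircularArcDrawing 3 (completeBipartiteGraph (Fin p) (Fin q)))
    (𝒮 : Finset (Set (EuclideanSpace ℝ (Fin 3)))) (h : D.ArcsInSpheres 𝒮) :
    p * q ≤ 𝒮.card * (2 * p + 2 * q - 4) := by
  classical
  have hex : ∀ x : Fin p × Fin q, ∃ S ∈ 𝒮, D.arc s(Sum.inl x.1, Sum.inr x.2) ⊆ S := fun x =>
    arc_subset_sphere (D.arc_isArc _ (mem_edge _ _)) (arc_nontrivial D _ _) 𝒮 h.1
      (h.2 _ (mem_edge _ _))
  choose f hf hfs using hex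
  have h1 := Finset.card_le_mul_card_image_of_maps_to (s := Finset.univ) (t := 𝒮) (f := f)
    (fun x _ => hf x) (2 * p + 2 * q - 4) (by
      intro S hS
      have := sphere_edges_bound hp hpq D (h.1 S hS)
        {x // x ∈ Finset.univ.filter (fun x => f x = S)} (fun x => x.1.1) (fun x => x.1.2)
        (fun e e' h1 h2 => Subtype.ext (Prod.ext h1 h2)) (fun e => by
          have := hfs e.1
          rwa [(Finset.mem_filter.1 e.2).2] at this)
      rw [Fintype.card_coe] at this
      omega)
  simpa [mul_comm] using h1

theorem lower_ceil {p q k : ℕ} (hpq : 3 ≤ p + q)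
    (h : p * q ≤ k * (2 * p + 2 * q - 4)) :
    (p * q + (2 * p + 2 * q - 4) - 1) / (2 * p + 2 * q - 4) ≤ k := by
  have hm : 0 < 2 * p + 2 * q - 4 := by omega
  generalize 2 * p + 2 * q - 4 = m at *
  rw [← Nat.lt_succ_iff, Nat.div_lt_iff_lt_mul hm, Nat.succ_mul]
  omega

theorem lower_half {p q k : ℕ} (hp : 1 ≤ p) (hpq : 3 ≤ p + q) (hq : q > p * (p - 1))
    (h : p * q ≤ k * (2 * p + 2 * q - 4)) : (p + 1) / 2 ≤ k := by
  by_contra hlt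
  have hk : 2 * k + 1 ≤ p := by omega
  obtain ⟨a, rfl⟩ : ∃ a, p = a + 1 := ⟨p - 1, by omega⟩
  have e : 2 * (a + 1) + 2 * q - 4 = 2 * (a + q - 1) := by omega
  rw [e] at h
  have h2 : k * (2 * (a + q - 1)) ≤ a * (a + q - 1) := by
    rw [← mul_assoc]; exact Nat.mul_le_mul_right _ (by omega)
  obtain ⟨b, rfl⟩ : ∃ b, q = b + 1 := ⟨q - 1, by omega⟩
  have e2 : a + (b + 1) - 1 = a + b := by omega
  rw [e2] at h h2
  simp only [Nat.add_sub_cancel] at hq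
  nlinarith

end SphereCover

namespace SphereCover

/-- The lifted arc from the point `(w, 0)` to the apex `(0, 0, h)`. -/
def upArc (h x y : ℝ) : Set (EuclideanSpace ℝ (Fin 3)) :=
  (fun l : ℝ => (!₂[√((1 - l) * (1 + l * h ^ 2)) * x, √((1 - l) * (1 + l * h ^ 2)) * y, l * h] :
    EuclideanSpace ℝ (Fin 3))) '' Icc 0 1

/-- The sphere through the unit circle with centre at height `t`. -/
def upSphere (t : ℝ) : Set (EuclideanSpace ℝ (Fin 3)) :=
  {x | dist x !₂[0, 0, t] = √(1 + t ^ 2)}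

lemma mem_upSphere {t : ℝ} {x : EuclideanSpace ℝ (Fin 3)} :
    x ∈ upSphere t ↔ x 0 ^ 2 + x 1 ^ 2 + x 2 ^ 2 - 2 * t * x 2 = 1 := by
  unfold upSphere
  rw [mem_ofPred_eq, EuclideanSpace.dist_eq, Real.sqrt_inj (by positivity) (by positivity)]
  simp [Fin.sum_univ_three, Real.dist_eq, sq_abs]
  constructor <;> intro h <;> linarith

lemma upSphere_isSphere (t : ℝ) : IsSphereDim 3 2 (upSphere t) :=
  ⟨⊤, !₂[0, 0, t], √(1 + t ^ 2), by rw [AffineSubspace.direction_top]; simp, by simp, by positivity, by simp [upSphere]⟩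

/-- Height of the centre of the sphere that belongs to the apex height `h`. -/
def ctr (h : ℝ) : ℝ := (h - 1 / h) / 2

lemma upArc_sub_sphere {h x y : ℝ} (hh : h ≠ 0) (hxy : x ^ 2 + y ^ 2 = 1) :
    upArc h x y ⊆ upSphere (ctr h) := by
  rintro _ ⟨l, ⟨hl0, hl1⟩, rfl⟩
  rw [mem_upSphere]
  have h0 : 0 ≤ (1 - l) * (1 + l * h ^ 2) := mul_nonneg (by linarith) (by positivity)
  have h1 := Real.sq_sqrt h0
  simp [ctr]
  rw [mul_pow, mul_pow, h1]
  field_simp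
  linear_combination ((1 - l) * (1 + l * h ^ 2)) * hxy

lemma upArc_isArc {h x y : ℝ} (hh : h ≠ 0) (hxy : x ^ 2 + y ^ 2 = 1) : IsArc 3 (upArc h x y) := by
  have hcont : Continuous (fun l : ℝ => (!₂[√((1 - l) * (1 + l * h ^ 2)) * x,
      √((1 - l) * (1 + l * h ^ 2)) * y, l * h] : EuclideanSpace ℝ (Fin 3))) := by
    apply (PiLp.continuous_toLp 2 _).comp
    apply continuous_pi
    intro i
    fin_cases i <;> simp <;> fun_prop
  let W : Submodule ℝ (EuclideanSpace ℝ (Fin 3)) :=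
    Submodule.span ℝ (Set.range ![!₂[x, y, 0], !₂[0, 0, 1]])
  have hW : Module.finrank ℝ W = 2 := by
    have : LinearIndependent ℝ ![(!₂[x, y, 0] : EuclideanSpace ℝ (Fin 3)), !₂[0, 0, 1]] := by
      rw [LinearIndependent.pair_iff]
      intro s t hst
      have e0 := congrArg (fun v : EuclideanSpace ℝ (Fin 3) => v 0) hst
      have e1 := congrArg (fun v : EuclideanSpace ℝ (Fin 3) => v 1) hst
      have e2 := congrArg (fun v : EuclideanSpace ℝ (Fin 3) => v 2) hst
      simp at e0 e1 e2
      refine ⟨?_, e2⟩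
      rcases e0 with h | h
      · exact h
      · rcases e1 with h' | h'
        · exact h'
        · rw [h, h'] at hxy; norm_num at hxy
    rw [finrank_span_eq_card this]; simp
  have hmem : ∀ a b : ℝ, (!₂[a * x, a * y, b] : EuclideanSpace ℝ (Fin 3)) ∈ W := by
    intro a b
    have : (!₂[a * x, a * y, b] : EuclideanSpace ℝ (Fin 3)) = a • !₂[x, y, 0] + b • !₂[0, 0, 1] := by
      ext i; fin_cases i <;> simp
    rw [this]
    exact W.add_mem (W.smul_mem _ (Submodule.subset_span ⟨0, rfl⟩))
      (W.smul_mem _ (Submodule.subset_span ⟨1, rfl⟩))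
  refine ⟨{z | z ∈ W.toAffineSubspace ∧ dist z !₂[0, 0, ctr h] = √(1 + ctr h ^ 2)},
    ⟨W.toAffineSubspace, !₂[0, 0, ctr h], √(1 + ctr h ^ 2), ?_, ?_, by positivity, rfl⟩, ?_, ?_, ?_⟩
  · rw [Submodule.toAffineSubspace_direction]; exact hW
  · simpa using hmem 0 (ctr h)
  · intro z hz
    refine ⟨?_, upArc_sub_sphere hh hxy hz⟩
    obtain ⟨l, -, rfl⟩ := hz
    exact hmem _ _
  · exact isCompact_Icc.image hcont
  · exact (isConnected_Icc zero_le_one).image _ hcont.continuousOn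

lemma ctr_inj {h h' : ℝ} (hh : 0 < h * h') (he : ctr h = ctr h') : h = h' := by
  have h0 : h ≠ 0 := by rintro rfl; simp at hh
  have h0' : h' ≠ 0 := by rintro rfl; simp at hh
  unfold ctr at he
  field_simp at he
  have : (h - h') * (h * h' + 1) = 0 := by nlinarith
  rcases mul_eq_zero.1 this with h | h
  · linarith
  · linarith

/-- Points common to two arcs. -/
lemma upArc_inter {h x y h' x' y' : ℝ} (hh : h ≠ 0) (hh' : h' ≠ 0) (hxy : x ^ 2 + y ^ 2 = 1)
    (hxy' : x' ^ 2 + y' ^ 2 = 1) {z : EuclideanSpace ℝ (Fin 3)} (hz : z ∈ upArc h x y)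
    (hz' : z ∈ upArc h' x' y') :
    (x = x' ∧ y = y' ∧ z = !₂[x, y, 0]) ∨ (h = h' ∧ z = !₂[0, 0, h]) ∨
      (h = h' ∧ x = x' ∧ y = y') := by
  have s1 := mem_upSphere.1 (upArc_sub_sphere hh hxy hz)
  have s2 := mem_upSphere.1 (upArc_sub_sphere hh' hxy' hz')
  obtain ⟨l, ⟨hl0, hl1⟩, rfl⟩ := hz
  obtain ⟨l', ⟨hl0', hl1'⟩, heq⟩ := hz'
  have e0 := congrArg (fun v : EuclideanSpace ℝ (Fin 3) => v 0) heq
  have e1 := congrArg (fun v : EuclideanSpace ℝ (Fin 3) => v 1) heq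
  have e2 := congrArg (fun v : EuclideanSpace ℝ (Fin 3) => v 2) heq
  simp only [Matrix.cons_val_zero, Matrix.cons_val_one, Matrix.cons_val] at e0 e1 e2 s1 s2
  by_cases hl : l = 0
  · subst hl
    have : l' = 0 := by
      simpa [hh'] using e2
    subst this
    left
    simp at e0 e1
    refine ⟨e0.symm, e1.symm, ?_⟩
    simp
  · have hlp : 0 < l := lt_of_le_of_ne hl0 (Ne.symm hl)
    have hzne : l * h ≠ 0 := mul_ne_zero hl hh
    have hl' : l' ≠ 0 := by
      rintro rfl
      rw [zero_mul] at e2; exact hzne e2.symm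
    have hlp' : 0 < l' := lt_of_le_of_ne hl0' (Ne.symm hl')
    have hctr : ctr h = ctr h' := by
      have : ctr h * (l * h) = ctr h' * (l * h) := by linarith
      exact mul_right_cancel₀ hzne this
    have hpos : 0 < h * h' := by
      have h1 : 0 < (l * h) * (l' * h') := by rw [e2]; exact mul_self_pos.2 hzne
      have h2 : (l * h) * (l' * h') = (l * l') * (h * h') := by ring
      rw [h2] at h1
      exact (pos_iff_pos_of_mul_pos h1).1 (by positivity)
    have := ctr_inj hpos hctr
    subst this
    have hll : l' = l := mul_right_cancel₀ hh e2
    subst hll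
    right
    by_cases hs : √((1 - l') * (1 + l' * h ^ 2)) = 0
    · left
      refine ⟨rfl, ?_⟩
      have h0 : 0 ≤ (1 - l') * (1 + l' * h ^ 2) := mul_nonneg (by linarith) (by positivity)
      have h3 := (Real.sqrt_eq_zero h0).1 hs
      have h4 : l' = 1 := by
        rcases mul_eq_zero.1 h3 with h | h5
        · linarith
        · have : 0 ≤ l' * h ^ 2 := by positivity
          linarith
      subst h4
      simp
    · right
      exact ⟨rfl, (mul_left_cancel₀ hs e0).symm, (mul_left_cancel₀ hs e1).symm⟩

lemma upArc_left {h x y : ℝ} : (!₂[x, y, 0] : EuclideanSpace ℝ (Fin 3)) ∈ upArc h x y :=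
  ⟨0, by simp, by simp⟩

lemma upArc_right {h x y : ℝ} : (!₂[0, 0, h] : EuclideanSpace ℝ (Fin 3)) ∈ upArc h x y :=
  ⟨1, by simp, by simp⟩

/-- Apex heights. -/
def ht (i : ℕ) : ℝ := if i % 2 = 0 then ((i / 2 : ℕ) : ℝ) + 1 else -1 / (((i / 2 : ℕ) : ℝ) + 1)

lemma ht_ne (i : ℕ) : ht i ≠ 0 := by
  unfold ht
  have : ((i / 2 : ℕ) : ℝ) + 1 > 0 := by positivity
  split_ifs
  · positivity
  · apply div_ne_zero (by norm_num) this.ne'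

lemma ht_inj {i j : ℕ} (h : ht i = ht j) : i = j := by
  unfold ht at h
  have h1 : ((i / 2 : ℕ) : ℝ) + 1 > 0 := by positivity
  have h2 : ((j / 2 : ℕ) : ℝ) + 1 > 0 := by positivity
  have h3 : -1 / (((i / 2 : ℕ) : ℝ) + 1) < 0 := div_neg_of_neg_of_pos (by norm_num) h1
  have h4 : -1 / (((j / 2 : ℕ) : ℝ) + 1) < 0 := div_neg_of_neg_of_pos (by norm_num) h2
  split_ifs at h with a b b
  · have : ((i / 2 : ℕ) : ℝ) = ((j / 2 : ℕ) : ℝ) := by linarith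
    have := Nat.cast_injective this
    omega
  · linarith
  · linarith
  · have : ((i / 2 : ℕ) : ℝ) = ((j / 2 : ℕ) : ℝ) := by
      rw [div_eq_div_iff h1.ne' h2.ne'] at h
      linarith
    have := Nat.cast_injective this
    omega

lemma ctr_ht (i : ℕ) : ctr (ht i) = ctr (((i / 2 : ℕ) : ℝ) + 1) := by
  unfold ht
  split_ifs
  · rfl
  · unfold ctr
    have : ((i / 2 : ℕ) : ℝ) + 1 ≠ 0 := by positivity
    field_simp
    ring

/-- Coordinates of the vertices on the unit circle. -/
def wx (j : ℕ) : ℝ := 1 / ((j : ℝ) + 1)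
def wy (j : ℕ) : ℝ := √(1 - wx j ^ 2)

lemma w_unit (j : ℕ) : wx j ^ 2 + wy j ^ 2 = 1 := by
  unfold wy
  rw [Real.sq_sqrt]
  · ring
  · unfold wx
    rw [sub_nonneg, div_pow, one_pow, div_le_one (by positivity)]
    nlinarith [Nat.cast_nonneg (α := ℝ) j]

lemma wx_inj {i j : ℕ} (h : wx i = wx j) : i = j := by
  unfold wx at h
  rw [div_eq_div_iff (by positivity) (by positivity)] at h
  have : (i : ℝ) = j := by linarith
  exact Nat.cast_injective this

/-- Vertex positions of the drawing. -/
def vpos (p q : ℕ) : Fin p ⊕ Fin q → EuclideanSpace ℝ (Fin 3) :=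
  Sum.elim (fun i => !₂[0, 0, ht i]) (fun j => !₂[wx j, wy j, 0])

/-- Arcs of the drawing. -/
def varc (p q : ℕ) (e : Sym2 (Fin p ⊕ Fin q)) : Set (EuclideanSpace ℝ (Fin 3)) :=
  {z | ∃ (i : Fin p) (j : Fin q), e = s(Sum.inl i, Sum.inr j) ∧ z ∈ upArc (ht i) (wx j) (wy j)}

lemma varc_eq {p q : ℕ} (i : Fin p) (j : Fin q) :
    varc p q s(Sum.inl i, Sum.inr j) = upArc (ht i) (wx j) (wy j) := by
  ext z
  constructor
  · rintro ⟨i', j', h, hz⟩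
    have h' : i = i' ∧ j = j' := by simpa using h
    obtain ⟨rfl, rfl⟩ := h'
    exact hz
  · intro hz
    exact ⟨i, j, rfl, hz⟩

lemma edge_form {p q : ℕ} {e : Sym2 (Fin p ⊕ Fin q)}
    (he : e ∈ (completeBipartiteGraph (Fin p) (Fin q)).edgeSet) :
    ∃ i j, e = s(Sum.inl i, Sum.inr j) := by
  induction e using Sym2.ind with
  | _ a b =>
    rcases a with i | i <;> rcases b with j | j
    · simp [completeBipartiteGraph] at he
    · exact ⟨i, j, rfl⟩
    · exact ⟨j, i, Sym2.eq_swap⟩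
    · simp [completeBipartiteGraph] at he

lemma apex_ne (h x y : ℝ) (hh : h ≠ 0) :
    (!₂[0, 0, h] : EuclideanSpace ℝ (Fin 3)) ≠ !₂[x, y, 0] := by
  intro h0
  have e2 := congrArg (fun v : EuclideanSpace ℝ (Fin 3) => v 2) h0
  simp at e2
  exact hh e2

/-- The drawing of the complete bipartite graph. -/
def theDrawing (p q : ℕ) : CircularArcDrawing 3 (completeBipartiteGraph (Fin p) (Fin q)) where
  pos := vpos p q
  inj := by
    rintro (i | i) (j | j) h
    · have e2 := congrArg (fun v : EuclideanSpace ℝ (Fin 3) => v 2) h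
      simp [vpos] at e2
      rw [Fin.ext (ht_inj e2)]
    · exact absurd h (apex_ne _ _ _ (ht_ne _))
    · exact absurd h.symm (apex_ne _ _ _ (ht_ne _))
    · have e0 := congrArg (fun v : EuclideanSpace ℝ (Fin 3) => v 0) h
      simp [vpos] at e0
      rw [Fin.ext (wx_inj e0)]
  arc := varc p q
  arc_isArc := by
    intro e he
    obtain ⟨i, j, rfl⟩ := edge_form he
    rw [varc_eq]
    exact upArc_isArc (ht_ne _) (w_unit _)
  endpoint_mem := by
    intro e he v hv
    obtain ⟨i, j, rfl⟩ := edge_form he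
    rw [varc_eq]
    rcases Sym2.mem_iff.1 hv with rfl | rfl
    · exact upArc_right
    · exact upArc_left
  crossFree := by
    intro e he f hf hef
    obtain ⟨i, j, rfl⟩ := edge_form he
    obtain ⟨i', j', rfl⟩ := edge_form hf
    rw [varc_eq, varc_eq]
    ext z
    constructor
    · rintro ⟨h1, h2⟩
      rcases upArc_inter (ht_ne _) (ht_ne _) (w_unit _) (w_unit _) h1 h2 with
        ⟨h3, -, rfl⟩ | ⟨h3, rfl⟩ | ⟨h3, h4, -⟩
      · have : j = j' := Fin.ext (wx_inj h3)
        subst this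
        exact ⟨Sum.inr j, ⟨by simp, by simp⟩, rfl⟩
      · have : i = i' := Fin.ext (ht_inj h3)
        subst this
        exact ⟨Sum.inl i, ⟨by simp, by simp⟩, rfl⟩
      · exact absurd (by rw [Fin.ext (ht_inj h3), Fin.ext (wx_inj h4)]) hef
    · rintro ⟨w, ⟨h1, h2⟩, rfl⟩
      constructor
      · rcases Sym2.mem_iff.1 h1 with rfl | rfl
        · exact upArc_right
        · exact upArc_left
      · rcases Sym2.mem_iff.1 h2 with rfl | rfl
        · exact upArc_right
        · exact upArc_left
  vertex_mem := by
    intro e he w hw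
    obtain ⟨i, j, rfl⟩ := edge_form he
    rw [varc_eq] at hw
    rcases w with i' | j'
    · have h2 : vpos p q (Sum.inl i') ∈ upArc (ht i') (wx j) (wy j) := upArc_right
      rcases upArc_inter (ht_ne _) (ht_ne _) (w_unit _) (w_unit _) hw h2 with
        ⟨-, -, h3⟩ | ⟨h3, -⟩ | ⟨h3, -, -⟩
      · exact absurd h3 (apex_ne _ _ _ (ht_ne _))
      · rw [Fin.ext (ht_inj h3)]; simp
      · rw [Fin.ext (ht_inj h3)]; simp
    · have h2 : vpos p q (Sum.inr j') ∈ upArc (ht i) (wx j') (wy j') := upArc_left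
      rcases upArc_inter (ht_ne _) (ht_ne _) (w_unit _) (w_unit _) hw h2 with
        ⟨h3, -, -⟩ | ⟨-, h3⟩ | ⟨-, h3, -⟩
      · rw [Fin.ext (wx_inj h3)]; simp
      · exact absurd h3.symm (apex_ne _ _ _ (ht_ne _))
      · rw [Fin.ext (wx_inj h3)]; simp

theorem upper (p q : ℕ) : ∃ (D : CircularArcDrawing 3 (completeBipartiteGraph (Fin p) (Fin q)))
    (𝒮 : Finset (Set (EuclideanSpace ℝ (Fin 3)))), D.ArcsInSpheres 𝒮 ∧ 𝒮.card ≤ (p + 1) / 2 := by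
  classical
  refine ⟨theDrawing p q,
    (Finset.range ((p + 1) / 2)).image (fun k : ℕ => upSphere (ctr ((k : ℝ) + 1))), ⟨?_, ?_⟩, ?_⟩
  · intro S hS
    obtain ⟨k, -, rfl⟩ := Finset.mem_image.1 hS
    exact upSphere_isSphere _
  · intro e he
    obtain ⟨i, j, rfl⟩ := edge_form he
    change varc p q _ ⊆ _
    rw [varc_eq]
    refine (upArc_sub_sphere (ht_ne _) (w_unit _)).trans ?_
    rw [ctr_ht]
    intro z hz
    refine mem_iUnion₂.2 ⟨_, Finset.mem_image.2 ⟨(i : ℕ) / 2, ?_, rfl⟩, hz⟩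
    rw [Finset.mem_range]
    have := i.2
    omega
  · exact Finset.card_image_le.trans (by simp)

end SphereCover

/-- For `1 ≤ p ≤ q` with `p + q ≥ 3`, the spherical cover number `σ²₃(K_{p,q})` satisfies
`⌈pq/(2p + 2q − 4)⌉ ≤ σ²₃(K_{p,q}) ≤ p`; moreover, if additionally `q > p(p − 1)`, then
`σ²₃(K_{p,q}) = ⌈p/2⌉`.  (Upper bounds are witnessed by drawings whose arcs lie in the
union of that many spheres; lower bounds hold for every drawing and every sphere family
containing its arcs.) -/
theorem sphere_cover_completeBipartiteGraph (p q : ℕ) (hp : 1 ≤ p) (hpq : p ≤ q)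
    (hsum : 3 ≤ p + q) :
    (∃ (D : CircularArcDrawing 3 (completeBipartiteGraph (Fin p) (Fin q)))
        (𝒮 : Finset (Set (EuclideanSpace ℝ (Fin 3)))),
        D.ArcsInSpheres 𝒮 ∧ 𝒮.card ≤ p) ∧
    (∀ (D : CircularArcDrawing 3 (completeBipartiteGraph (Fin p) (Fin q)))
        (𝒮 : Finset (Set (EuclideanSpace ℝ (Fin 3)))),
        D.ArcsInSpheres 𝒮 →
        (p * q + (2 * p + 2 * q - 4) - 1) / (2 * p + 2 * q - 4) ≤ 𝒮.card) ∧
    (q > p * (p - 1) →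
      (∃ (D : CircularArcDrawing 3 (completeBipartiteGraph (Fin p) (Fin q)))
          (𝒮 : Finset (Set (EuclideanSpace ℝ (Fin 3)))),
          D.ArcsInSpheres 𝒮 ∧ 𝒮.card ≤ (p + 1) / 2) ∧
      (∀ (D : CircularArcDrawing 3 (completeBipartiteGraph (Fin p) (Fin q)))
          (𝒮 : Finset (Set (EuclideanSpace ℝ (Fin 3)))),
          D.ArcsInSpheres 𝒮 → (p + 1) / 2 ≤ 𝒮.card)) := by
  have hle : (p + 1) / 2 ≤ p := by omega
  refine ⟨?_, ?_, ?_⟩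
  · obtain ⟨D, 𝒮, h1, h2⟩ := SphereCover.upper p q
    exact ⟨D, 𝒮, h1, h2.trans hle⟩
  · intro D 𝒮 h
    exact SphereCover.lower_ceil hsum (SphereCover.lower_mul hp hsum D 𝒮 h)
  · intro hq
    refine ⟨SphereCover.upper p q, ?_⟩
    intro D 𝒮 h
    exact SphereCover.lower_half hp hsum hq (SphereCover.lower_mul hp hsum D 𝒮 h)
end
end

section
/- Every crossing-free straight-line drawing of the icosahedron graph in ℝ³ that is covered by a family ℒ of lines satisfies |ℒ| ≥ 13. -/
open Set

noncomputable section

/-- A crossing-free straight-line drawing of a simple graph `G` in `ℝ^d`: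
an injective map of the vertices to points such that each edge `uv` is represented by the
closed segment between the images of `u` and `v`, the segments of two distinct edges
intersect exactly in the images of their common endpoints, and no vertex image lies on the
segment of a non-incident edge. -/
structure StraightLineDrawing (d : ℕ) {V : Type*} (G : SimpleGraph V) where
  pos : V → EuclideanSpace ℝ (Fin d)
  inj : Function.Injective pos
  crossFree : ∀ u v x y : V, G.Adj u v → G.Adj x y → s(u, v) ≠ s(x, y) →
    segment ℝ (pos u) (pos v) ∩ segment ℝ (pos x) (pos y)
      = pos '' ({u, v} ∩ {x, y} : Set V)
  vertex_mem : ∀ u v w : V, G.Adj u v → pos w ∈ segment ℝ (pos u) (pos v) → w = u ∨ w = v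

/-- The straight-line drawing `D` of `G` is covered by the family `ℒ` of lines
(1-dimensional affine subspaces): every edge segment lies in a line of `ℒ`. -/
def StraightLineDrawing.CoveredByLines {d : ℕ} {V : Type*} {G : SimpleGraph V}
    (D : StraightLineDrawing d G)
    (ℒ : Finset (AffineSubspace ℝ (EuclideanSpace ℝ (Fin d)))) : Prop :=
  (∀ L ∈ ℒ, Module.finrank ℝ L.direction = 1) ∧
  ∀ u v : V, G.Adj u v →
    ∃ L ∈ ℒ, segment ℝ (D.pos u) (D.pos v) ⊆ (L : Set (EuclideanSpace ℝ (Fin d)))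

/-- The 30 edges of the icosahedron graph on the vertex set `{0, …, 11}`:
`0` is adjacent to `1,…,5`; `1,…,5` form a 5-cycle in this order; `11` is adjacent to
`6,…,10`; `6,…,10` form a 5-cycle in this order; and for `i ∈ {1,…,5}`, vertex `i` is
adjacent to `i + 5` and to `(i mod 5) + 6`. -/
def icosahedronEdges : List (ℕ × ℕ) :=
  [(0, 1), (0, 2), (0, 3), (0, 4), (0, 5),
   (1, 2), (2, 3), (3, 4), (4, 5), (5, 1),
   (11, 6), (11, 7), (11, 8), (11, 9), (11, 10),
   (6, 7), (7, 8), (8, 9), (9, 10), (10, 6),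
   (1, 6), (2, 7), (3, 8), (4, 9), (5, 10),
   (1, 7), (2, 8), (3, 9), (4, 10), (5, 6)]

/-- The icosahedron graph: the 5-regular graph on 12 vertices which is the 1-skeleton of
the regular icosahedron. -/
def icosahedronGraph : SimpleGraph (Fin 12) :=
  SimpleGraph.fromRel (fun i j => ((i : ℕ), (j : ℕ)) ∈ icosahedronEdges)

/-! Two distinct points determine a line. -/

theorem ico_exists_param {E : Type*} [NormedAddCommGroup E] [NormedSpace ℝ E]
    (L : AffineSubspace ℝ E) (hL : Module.finrank ℝ L.direction = 1)
    {p q r : E} (hp : p ∈ L) (hq : q ∈ L) (hr : r ∈ L) (hpq : p ≠ q) :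
    ∃ t : ℝ, r - p = t • (q - p) := by
  have h1 : q - p ∈ L.direction := by simpa using AffineSubspace.vsub_mem_direction hq hp
  have h2 : r - p ∈ L.direction := by simpa using AffineSubspace.vsub_mem_direction hr hp
  have hne : (⟨q - p, h1⟩ : L.direction) ≠ 0 := by
    intro h
    have : q - p = 0 := congrArg Subtype.val h
    exact hpq (sub_eq_zero.mp this).symm
  obtain ⟨c, hc⟩ := (finrank_eq_one_iff_of_nonzero' _ hne).1 hL ⟨r - p, h2⟩
  exact ⟨c, (congrArg Subtype.val hc).symm⟩

theorem ico_mem_of_param {E : Type*} [NormedAddCommGroup E] [NormedSpace ℝ E]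
    (L : AffineSubspace ℝ E) {p q r : E} (hp : p ∈ L) (hq : q ∈ L) (t : ℝ)
    (h : r - p = t • (q - p)) : r ∈ L := by
  have := AffineMap.lineMap_mem t hp hq
  rw [AffineMap.lineMap_apply] at this
  have e : r = t • (q -ᵥ p) +ᵥ p := by
    simp only [vsub_eq_sub, vadd_eq_add, ← h]; abel
  rwa [e]

theorem ico_line_unique {E : Type*} [NormedAddCommGroup E] [NormedSpace ℝ E]
    (L M : AffineSubspace ℝ E) (hL : Module.finrank ℝ L.direction = 1)
    (hM : Module.finrank ℝ M.direction = 1)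
    {p q : E} (hpq : p ≠ q) (hp : p ∈ L) (hq : q ∈ L) (hp' : p ∈ M) (hq' : q ∈ M) : L = M := by
  ext r
  constructor
  · intro hr
    obtain ⟨t, ht⟩ := ico_exists_param L hL hp hq hr hpq
    exact ico_mem_of_param M hp' hq' t ht
  · intro hr
    obtain ⟨t, ht⟩ := ico_exists_param M hM hp' hq' hr hpq
    exact ico_mem_of_param L hp hq t ht

/-- Two neighbours of `v` on a common line through `v` lie on opposite sides of `v`. -/
theorem ico_opposite {V : Type*} {G : SimpleGraph V} (D : StraightLineDrawing 3 G)
    (v x y : V) (hx : G.Adj v x) (hy : G.Adj v y) (hxy : x ≠ y) (t : ℝ)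
    (h : D.pos y - D.pos v = t • (D.pos x - D.pos v)) : t < 0 := by
  by_contra hneg
  push Not at hneg
  rcases le_or_gt t 1 with h1 | h1
  · have : D.pos y ∈ segment ℝ (D.pos v) (D.pos x) := by
      rw [segment_eq_image']
      refine ⟨t, ⟨hneg, h1⟩, ?_⟩
      simp only [← h]; abel
    rcases D.vertex_mem v x y hx this with e | e
    · exact hy.ne e.symm
    · exact hxy e.symm
  · have : D.pos x ∈ segment ℝ (D.pos v) (D.pos y) := by
      rw [segment_eq_image']
      refine ⟨t⁻¹, ⟨by positivity, inv_le_one_of_one_le₀ h1.le⟩, ?_⟩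
      simp only [h]
      rw [smul_smul, inv_mul_cancel₀ (by positivity)]
      simp
    rcases D.vertex_mem v y x hy this with e | e
    · exact hx.ne e.symm
    · exact hxy e

/-- Nine positive points of a grid whose coordinates and ratios take at most three values. -/
theorem ico_grid {V : Type*} [DecidableEq V] (S : Finset V) (hS : 9 ≤ S.card) (p q r : V → ℝ)
    (hp : ∀ v ∈ S, 0 < p v) (hq : ∀ v ∈ S, 0 < q v)
    (hr : ∀ v ∈ S, r v = p v / q v)
    (hinj : ∀ v ∈ S, ∀ w ∈ S, p v = p w → q v = q w → v = w)
    (h1 : (S.image p).card ≤ 3) (h2 : (S.image q).card ≤ 3) (h3 : (S.image r).card ≤ 3) :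
    False := by
  classical
  have hc : (S.image fun v => (p v, q v)).card = S.card := by
    apply Finset.card_image_of_injOn
    intro v hv w hw h
    simp only [Prod.mk.injEq] at h
    exact hinj v hv w hw h.1 h.2
  have hsub : (S.image fun v => (p v, q v)) ⊆ S.image p ×ˢ S.image q := by
    intro z hz
    obtain ⟨v, hv, rfl⟩ := Finset.mem_image.1 hz
    exact Finset.mem_product.2 ⟨Finset.mem_image_of_mem _ hv, Finset.mem_image_of_mem _ hv⟩
  have hle := Finset.card_le_card hsub
  rw [Finset.card_product, hc] at hle
  have e1 : (S.image p).card = 3 := by nlinarith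
  have e2 : (S.image q).card = 3 := by nlinarith
  have heq := Finset.eq_of_subset_of_card_le hsub (by
    rw [Finset.card_product, e1, e2, hc]; omega)
  have hmem : ∀ a ∈ S.image p, ∀ b ∈ S.image q, 0 < a ∧ 0 < b ∧ a / b ∈ S.image r := by
    intro a ha b hb
    have : (a, b) ∈ S.image p ×ˢ S.image q := Finset.mem_product.2 ⟨ha, hb⟩
    rw [← heq] at this
    obtain ⟨v, hv, h⟩ := Finset.mem_image.1 this
    simp only [Prod.mk.injEq] at h
    obtain ⟨rfl, rfl⟩ := h
    exact ⟨hp v hv, hq v hv, Finset.mem_image.2 ⟨v, hv, hr v hv⟩⟩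
  let f := (S.image p).orderEmbOfFin e1
  let g := (S.image q).orderEmbOfFin e2
  have hf : ∀ i, f i ∈ S.image p := fun i => Finset.orderEmbOfFin_mem _ e1 i
  have hg : ∀ i, g i ∈ S.image q := fun i => Finset.orderEmbOfFin_mem _ e2 i
  have f01 : f 0 < f 1 := f.strictMono (by decide)
  have g01 : g 0 < g 1 := g.strictMono (by decide)
  have g12 : g 1 < g 2 := g.strictMono (by decide)
  have a02 := hmem _ (hf 0) _ (hg 2)
  have a01 := hmem _ (hf 0) _ (hg 1)
  have a00 := hmem _ (hf 0) _ (hg 0)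
  have a10 := hmem _ (hf 1) _ (hg 0)
  have l1 : f 0 / g 2 < f 0 / g 1 := div_lt_div_of_pos_left a02.1 a01.2.1 g12
  have l2 : f 0 / g 1 < f 0 / g 0 := div_lt_div_of_pos_left a02.1 a00.2.1 g01
  have l3 : f 0 / g 0 < f 1 / g 0 := div_lt_div_of_pos_right f01 a00.2.1
  have hs : ({f 0 / g 2, f 0 / g 1, f 0 / g 0, f 1 / g 0} : Finset ℝ) ⊆ S.image r := by
    intro z hz
    simp only [Finset.mem_insert, Finset.mem_singleton] at hz
    rcases hz with rfl | rfl | rfl | rfl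
    exacts [a02.2.2, a01.2.2, a00.2.2, a10.2.2]
  have h4 : ({f 0 / g 2, f 0 / g 1, f 0 / g 0, f 1 / g 0} : Finset ℝ).card = 4 := by
    rw [Finset.card_insert_of_notMem, Finset.card_insert_of_notMem,
      Finset.card_insert_of_notMem, Finset.card_singleton]
    · simp only [Finset.mem_singleton]; exact l3.ne
    · simp only [Finset.mem_insert, Finset.mem_singleton]
      rintro (h | h) <;> linarith
    · simp only [Finset.mem_insert, Finset.mem_singleton]
      rintro (h | h | h) <;> linarith
  have := Finset.card_le_card hs
  omega

theorem ico_nbrs (v : Fin 12) : ∃ N : Finset (Fin 12), N.card = 5 ∧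
    ∀ x ∈ N, icosahedronGraph.Adj v x := by
  refine ⟨Finset.univ.filter fun x => v ≠ x ∧
    (((v : ℕ), (x : ℕ)) ∈ icosahedronEdges ∨ ((x : ℕ), (v : ℕ)) ∈ icosahedronEdges), ?_, ?_⟩
  · revert v; decide
  · intro x hx
    simpa [icosahedronGraph, SimpleGraph.fromRel_adj] using hx

/-- If `g v` is determined by `φ v` then `g` takes at most as many values as `φ`. -/
theorem ico_card_image {V W : Type*} [Nonempty V] [DecidableEq W] (S : Finset V) (φ : V → W) (g : V → ℝ)
    (T : Finset W) (hφ : ∀ v ∈ S, φ v ∈ T)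
    (h : ∀ v ∈ S, ∀ w ∈ S, φ v = φ w → g v = g w) : (S.image g).card ≤ T.card := by
  classical
  have : ∀ z ∈ S.image g, ∃ v ∈ S, g v = z := fun z hz => by simpa using hz
  choose! k hk hk' using this
  apply Finset.card_le_card_of_injOn (fun z => φ (k z))
  · intro z hz; exact hφ _ (hk z hz)
  · intro z hz z' hz' e
    have := h _ (hk z hz) _ (hk z' hz') e
    rwa [hk' z hz, hk' z' hz'] at this

/-- The lines of the family which carry an edge at `v`. -/
def icoT (D : StraightLineDrawing 3 icosahedronGraph)
    (ℒ : Finset (AffineSubspace ℝ (EuclideanSpace ℝ (Fin 3)))) (v : Fin 12) :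
    Finset (AffineSubspace ℝ (EuclideanSpace ℝ (Fin 3))) :=
  open Classical in ℒ.filter fun L => D.pos v ∈ L ∧ ∃ x, x ≠ v ∧ D.pos x ∈ L

theorem ico_mem_T (D : StraightLineDrawing 3 icosahedronGraph)
    (ℒ : Finset (AffineSubspace ℝ (EuclideanSpace ℝ (Fin 3))))
    {v : Fin 12} {L : AffineSubspace ℝ (EuclideanSpace ℝ (Fin 3))} :
    L ∈ icoT D ℒ v ↔ L ∈ ℒ ∧ D.pos v ∈ L ∧ ∃ x, x ≠ v ∧ D.pos x ∈ L := by
  classical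
  simp [icoT]

theorem ico_line_choice (D : StraightLineDrawing 3 icosahedronGraph)
    (ℒ : Finset (AffineSubspace ℝ (EuclideanSpace ℝ (Fin 3))))
    (hcov : D.CoveredByLines ℒ) (v x : Fin 12) (h : icosahedronGraph.Adj v x) :
    ∃ L ∈ icoT D ℒ v, D.pos x ∈ L := by
  obtain ⟨L, hL, hs⟩ := hcov.2 v x h
  exact ⟨L, (ico_mem_T D ℒ).2 ⟨hL, hs (left_mem_segment ..), x, h.ne.symm,
    hs (right_mem_segment ..)⟩, hs (right_mem_segment ..)⟩

theorem ico_T_ge_three (D : StraightLineDrawing 3 icosahedronGraph)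
    (ℒ : Finset (AffineSubspace ℝ (EuclideanSpace ℝ (Fin 3))))
    (hcov : D.CoveredByLines ℒ) (v : Fin 12) : 3 ≤ (icoT D ℒ v).card := by
  classical
  obtain ⟨N, hN, hadj⟩ := ico_nbrs v
  choose! f hf hf' using ico_line_choice D ℒ hcov v
  by_contra hlt
  have hlt' : (icoT D ℒ v).card * 2 < N.card := by omega
  obtain ⟨L, hL, h2⟩ := Finset.exists_lt_card_fiber_of_mul_lt_card_of_maps_to
    (f := f) (fun x hx => hf x (hadj x hx)) hlt'
  obtain ⟨x, y, z, hx, hy, hz, hxy, hxz, hyz⟩ := Finset.two_lt_card_iff.1 h2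
  simp only [Finset.mem_filter] at hx hy hz
  have gx := hf' x (hadj x hx.1)
  have gy := hf' y (hadj y hy.1)
  have gz := hf' z (hadj z hz.1)
  rw [hx.2] at gx
  rw [hy.2] at gy
  rw [hz.2] at gz
  have hl := (ico_mem_T D ℒ).1 hL
  have d1 := hcov.1 L hl.1
  have nx : D.pos v ≠ D.pos x := fun e => (hadj x hx.1).ne (D.inj e)
  obtain ⟨s, hs⟩ := ico_exists_param L d1 hl.2.1 gx gy nx
  obtain ⟨t, ht⟩ := ico_exists_param L d1 hl.2.1 gx gz nx
  have s0 := ico_opposite D v x y (hadj x hx.1) (hadj y hy.1) hxy s hs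
  have t0 := ico_opposite D v x z (hadj x hx.1) (hadj z hz.1) hxz t ht
  have := ico_opposite D v y z (hadj y hy.1) (hadj z hz.1) hyz (t / s) (by
    rw [hs, ht, smul_smul, div_mul_cancel₀ _ s0.ne])
  have := div_pos_of_neg_of_neg t0 s0
  linarith

theorem ico_T_extreme (D : StraightLineDrawing 3 icosahedronGraph)
    (ℒ : Finset (AffineSubspace ℝ (EuclideanSpace ℝ (Fin 3))))
    (hcov : D.CoveredByLines ℒ) (v : Fin 12)
    (hv : D.pos v ∈ Set.extremePoints ℝ (convexHull ℝ (Set.range D.pos))) :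
    5 ≤ (icoT D ℒ v).card := by
  classical
  obtain ⟨N, hN, hadj⟩ := ico_nbrs v
  choose! f hf hf' using ico_line_choice D ℒ hcov v
  rw [← hN]
  apply Finset.card_le_card_of_injOn f (fun x hx => hf x (hadj x hx))
  intro x hx y hy e
  by_contra hxy
  have ax := hadj x hx
  have ay := hadj y hy
  have gx := hf' x ax
  have gy := hf' y ay
  rw [← e] at gy
  have hl := (ico_mem_T D ℒ).1 (hf x ax)
  have nx : D.pos v ≠ D.pos x := fun e => ax.ne (D.inj e)
  obtain ⟨t, ht⟩ := ico_exists_param _ (hcov.1 _ hl.1) hl.2.1 gx gy nx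
  have t0 := ico_opposite D v x y ax ay hxy t ht
  have ho : D.pos v ∈ openSegment ℝ (D.pos x) (D.pos y) := by
    have hp : 0 < 1 - t := by linarith
    refine ⟨-t / (1 - t), 1 / (1 - t), div_pos (by linarith) hp, by positivity, ?_, ?_⟩
    · field_simp; ring
    · have e2 : D.pos y = D.pos v + t • (D.pos x - D.pos v) := by rw [← ht]; abel
      rw [e2]
      match_scalars
      · field_simp; ring
      · field_simp; ring
  have := hv.2 (subset_convexHull ℝ _ ⟨x, rfl⟩) (subset_convexHull ℝ _ ⟨y, rfl⟩) ho
  exact nx this.symm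

theorem ico_T_inter (D : StraightLineDrawing 3 icosahedronGraph)
    (ℒ : Finset (AffineSubspace ℝ (EuclideanSpace ℝ (Fin 3))))
    (hcov : D.CoveredByLines ℒ) {v w : Fin 12} (hvw : v ≠ w)
    {L M : AffineSubspace ℝ (EuclideanSpace ℝ (Fin 3))}
    (h1 : L ∈ icoT D ℒ v) (h2 : L ∈ icoT D ℒ w) (h3 : M ∈ icoT D ℒ v) (h4 : M ∈ icoT D ℒ w) :
    L = M := by
  rw [ico_mem_T] at h1 h2 h3 h4
  exact ico_line_unique L M (hcov.1 L h1.1) (hcov.1 M h3.1) (fun e => hvw (D.inj e))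
    h1.2.1 h2.2.1 h3.2.1 h4.2.1

/-- Points on a common line through a corner of the triangle have equal ratios. -/
theorem ico_ratio {E : Type*} [NormedAddCommGroup E] [NormedSpace ℝ E]
    (L : AffineSubspace ℝ E) (hL : Module.finrank ℝ L.direction = 1) {A B C x y : E}
    (hind : ∀ a b : ℝ, a • (A - C) + b • (B - C) = 0 → a = 0 ∧ b = 0)
    (hC : C ∈ L) (hx : x ∈ L) (hy : y ∈ L) (hCx : C ≠ x)
    {u s t u' s' t' : ℝ} (h1 : u + s + t = 1) (h1' : u' + s' + t' = 1)
    (hu : 0 < u) (hu' : 0 < u')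
    (ex : x = u • A + s • B + t • C) (ey : y = u' • A + s' • B + t' • C) :
    s / u = s' / u' := by
  obtain ⟨k, hk⟩ := ico_exists_param L hL hC hx hy hCx
  have e : (u' - k * u) • (A - C) + (s' - k * s) • (B - C) = 0 := by
    have ht : t = 1 - u - s := by linarith
    have ht' : t' = 1 - u' - s' := by linarith
    have : (u' - k * u) • (A - C) + (s' - k * s) • (B - C) = (y - C) - k • (x - C) := by
      rw [ex, ey, ht, ht']
      module
    rw [this, hk, sub_self]
  obtain ⟨e1, e2⟩ := hind _ _ e
  rw [div_eq_div_iff hu.ne' hu'.ne']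
  have e1' : u' = k * u := by linarith
  have e2' : s' = k * s := by linarith
  rw [e1', e2']; ring

theorem ico_indep {E : Type*} [NormedAddCommGroup E] [NormedSpace ℝ E]
    (L : AffineSubspace ℝ E) {A B C : E} (hB : B ∈ L) (hC : C ∈ L) (hA : A ∉ L) (hBC : B ≠ C)
    (a b : ℝ) (h : a • (A - C) + b • (B - C) = 0) : a = 0 ∧ b = 0 := by
  have ha : a = 0 := by
    by_contra ha
    apply hA
    apply ico_mem_of_param L hC hB (-b / a)
    have : A - C = a⁻¹ • (a • (A - C)) := by rw [smul_smul, inv_mul_cancel₀ ha, one_smul]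
    rw [this, eq_neg_of_add_eq_zero_left h, ← neg_smul, smul_smul]
    congr 1; field_simp
  refine ⟨ha, ?_⟩
  rw [ha, zero_smul, zero_add, smul_eq_zero] at h
  exact h.resolve_right (sub_ne_zero.2 hBC)

theorem ico_corner (D : StraightLineDrawing 3 icosahedronGraph)
    (ℒ : Finset (AffineSubspace ℝ (EuclideanSpace ℝ (Fin 3)))) (S : Finset (Fin 12))
    (c : Fin 12) (h5 : (icoT D ℒ c).card = 5)
    (M N : AffineSubspace ℝ (EuclideanSpace ℝ (Fin 3)))
    (hM : M ∈ icoT D ℒ c) (hN : N ∈ icoT D ℒ c) (hMN : M ≠ N) (g : Fin 12 → ℝ)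
    (h1 : ∀ v ∈ S, ∃ L ∈ icoT D ℒ c, L ∈ icoT D ℒ v)
    (hoff : ∀ v ∈ S, D.pos v ∉ M ∧ D.pos v ∉ N)
    (hg : ∀ v ∈ S, ∀ w ∈ S, ∀ L ∈ icoT D ℒ c, D.pos v ∈ L → D.pos w ∈ L → g v = g w) :
    (S.image g).card ≤ 3 := by
  classical
  choose! φ hφ hφ' using h1
  have hc : (((icoT D ℒ c).erase M).erase N).card = 3 := by
    rw [Finset.card_erase_of_mem (Finset.mem_erase.2 ⟨hMN.symm, hN⟩),
      Finset.card_erase_of_mem hM, h5]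
  rw [← hc]
  have hmem : ∀ v ∈ S, D.pos v ∈ φ v := fun v hv => ((ico_mem_T D ℒ).1 (hφ' v hv)).2.1
  apply ico_card_image S φ
  · intro v hv
    refine Finset.mem_erase.2 ⟨?_, Finset.mem_erase.2 ⟨?_, hφ v hv⟩⟩
    · intro e; exact (hoff v hv).2 (e ▸ hmem v hv)
    · intro e; exact (hoff v hv).1 (e ▸ hmem v hv)
  · intro v hv w hw e
    exact hg v hv w hw (φ v) (hφ v hv) (hmem v hv) (e ▸ hmem w hw)

theorem ico_T_inter_card (D : StraightLineDrawing 3 icosahedronGraph)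
    (ℒ : Finset (AffineSubspace ℝ (EuclideanSpace ℝ (Fin 3))))
    [DecidableEq (AffineSubspace ℝ (EuclideanSpace ℝ (Fin 3)))]
    (hcov : D.CoveredByLines ℒ) {v w : Fin 12} (hvw : v ≠ w) :
    (icoT D ℒ v ∩ icoT D ℒ w).card ≤ 1 := by
  apply Finset.card_le_one.2
  intro L hL M hM
  rw [Finset.mem_inter] at hL hM
  exact ico_T_inter D ℒ hcov hvw hL.1 hL.2 hM.1 hM.2

/-- A vertex other than the corners lies off the side `M` of the triangle. -/
theorem ico_off_side (D : StraightLineDrawing 3 icosahedronGraph)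
    (ℒ : Finset (AffineSubspace ℝ (EuclideanSpace ℝ (Fin 3))))
    (hcov : D.CoveredByLines ℒ) {a b c v : Fin 12} (hva : v ≠ a) (hvb : v ≠ b) (hvc : v ≠ c)
    (hU : ∀ L ∈ ℒ, L ∈ icoT D ℒ a ∨ L ∈ icoT D ℒ b ∨ L ∈ icoT D ℒ c)
    (M : AffineSubspace ℝ (EuclideanSpace ℝ (Fin 3)))
    (hMa : M ∈ icoT D ℒ a) (hMb : M ∈ icoT D ℒ b) : D.pos v ∉ M := by
  classical
  intro hv
  have hMv : M ∈ icoT D ℒ v :=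
    (ico_mem_T D ℒ).2 ⟨((ico_mem_T D ℒ).1 hMa).1, hv, a, hva.symm, ((ico_mem_T D ℒ).1 hMa).2.1⟩
  have hsub : icoT D ℒ v ⊆ {M} ∪ (icoT D ℒ v ∩ icoT D ℒ c) := by
    intro L hL
    rw [Finset.mem_union, Finset.mem_singleton, Finset.mem_inter]
    rcases hU L ((ico_mem_T D ℒ).1 hL).1 with h | h | h
    · exact Or.inl (ico_T_inter D ℒ hcov hva hL h hMv hMa)
    · exact Or.inl (ico_T_inter D ℒ hcov hvb hL h hMv hMb)
    · exact Or.inr ⟨hL, h⟩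
  have h1 := Finset.card_le_card hsub
  have h2 := Finset.card_union_le {M} (icoT D ℒ v ∩ icoT D ℒ c)
  have h3 := ico_T_inter_card D ℒ hcov hvc
  have h4 := ico_T_ge_three D ℒ hcov v
  rw [Finset.card_singleton] at h2
  omega

/-- Every vertex other than the corners sees each corner along a line of the family. -/
theorem ico_sees (D : StraightLineDrawing 3 icosahedronGraph)
    (ℒ : Finset (AffineSubspace ℝ (EuclideanSpace ℝ (Fin 3))))
    (hcov : D.CoveredByLines ℒ) {a b c v : Fin 12} (hvb : v ≠ b) (hvc : v ≠ c)
    (hU : ∀ L ∈ ℒ, L ∈ icoT D ℒ a ∨ L ∈ icoT D ℒ b ∨ L ∈ icoT D ℒ c) :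
    ∃ L ∈ icoT D ℒ a, L ∈ icoT D ℒ v := by
  classical
  by_contra hno
  push Not at hno
  have hsub : icoT D ℒ v ⊆ (icoT D ℒ v ∩ icoT D ℒ b) ∪ (icoT D ℒ v ∩ icoT D ℒ c) := by
    intro L hL
    rw [Finset.mem_union, Finset.mem_inter, Finset.mem_inter]
    rcases hU L ((ico_mem_T D ℒ).1 hL).1 with h | h | h
    · exact absurd hL (hno L h)
    · exact Or.inl ⟨hL, h⟩
    · exact Or.inr ⟨hL, h⟩
  have h1 := Finset.card_le_card hsub
  have h2 := Finset.card_union_le (icoT D ℒ v ∩ icoT D ℒ b) (icoT D ℒ v ∩ icoT D ℒ c)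
  have h3 := ico_T_inter_card D ℒ hcov hvb
  have h3' := ico_T_inter_card D ℒ hcov hvc
  have h4 := ico_T_ge_three D ℒ hcov v
  omega

theorem ico_triangle (D : StraightLineDrawing 3 icosahedronGraph)
    (ℒ : Finset (AffineSubspace ℝ (EuclideanSpace ℝ (Fin 3))))
    (hcov : D.CoveredByLines ℒ) (hcard : ℒ.card ≤ 12) {a b c : Fin 12}
    (hab : a ≠ b) (hac : a ≠ c) (hbc : b ≠ c)
    (ha : 5 ≤ (icoT D ℒ a).card) (hb : 5 ≤ (icoT D ℒ b).card) (hc : 5 ≤ (icoT D ℒ c).card)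
    (hhull : ∀ v, ∃ u s t : ℝ, 0 ≤ u ∧ 0 ≤ s ∧ 0 ≤ t ∧ u + s + t = 1 ∧
      D.pos v = u • D.pos a + s • D.pos b + t • D.pos c) : False := by
  classical
  have iab := ico_T_inter_card D ℒ hcov hab
  have iac := ico_T_inter_card D ℒ hcov hac
  have ibc := ico_T_inter_card D ℒ hcov hbc
  have hTL : ∀ v, icoT D ℒ v ⊆ ℒ := fun v L hL => ((ico_mem_T D ℒ).1 hL).1
  have k1 := Finset.card_union_add_card_inter (icoT D ℒ a) (icoT D ℒ b)
  have k2 := Finset.card_union_add_card_inter (icoT D ℒ a ∪ icoT D ℒ b) (icoT D ℒ c)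
  have k3 : ((icoT D ℒ a ∪ icoT D ℒ b) ∩ icoT D ℒ c).card + 
      ((icoT D ℒ a ∩ icoT D ℒ c) ∩ (icoT D ℒ b ∩ icoT D ℒ c)).card =
      (icoT D ℒ a ∩ icoT D ℒ c).card + (icoT D ℒ b ∩ icoT D ℒ c).card := by
    rw [Finset.union_inter_distrib_right, Finset.card_union_add_card_inter]
  have hUs : (icoT D ℒ a ∪ icoT D ℒ b) ∪ icoT D ℒ c ⊆ ℒ :=
    Finset.union_subset (Finset.union_subset (hTL a) (hTL b)) (hTL c)
  have k4 := Finset.card_le_card hUs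
  have hUeq := Finset.eq_of_subset_of_card_le hUs (by omega)
  have hU : ∀ L ∈ ℒ, L ∈ icoT D ℒ a ∨ L ∈ icoT D ℒ b ∨ L ∈ icoT D ℒ c := by
    intro L hL
    rw [← hUeq, Finset.mem_union, Finset.mem_union, or_assoc] at hL
    exact hL
  have hempty : ((icoT D ℒ a ∩ icoT D ℒ c) ∩ (icoT D ℒ b ∩ icoT D ℒ c)) = ∅ :=
    Finset.card_eq_zero.1 (by omega)
  obtain ⟨X, hX⟩ := Finset.card_pos.1 (show 0 < (icoT D ℒ a ∩ icoT D ℒ b).card by omega)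
  obtain ⟨Y, hY⟩ := Finset.card_pos.1 (show 0 < (icoT D ℒ a ∩ icoT D ℒ c).card by omega)
  obtain ⟨Z, hZ⟩ := Finset.card_pos.1 (show 0 < (icoT D ℒ b ∩ icoT D ℒ c).card by omega)
  rw [Finset.mem_inter] at hX hY hZ
  have hno : ∀ L, L ∈ icoT D ℒ a → L ∈ icoT D ℒ b → L ∈ icoT D ℒ c → False := by
    intro L h1 h2 h3
    have : L ∈ ((icoT D ℒ a ∩ icoT D ℒ c) ∩ (icoT D ℒ b ∩ icoT D ℒ c)) := by
      simp [h1, h2, h3]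
    rw [hempty] at this
    simp at this
  have hXY : X ≠ Y := fun e => hno X hX.1 hX.2 (e ▸ hY.2)
  have hXZ : X ≠ Z := fun e => hno X hX.1 hX.2 (e ▸ hZ.2)
  have hYZ : Y ≠ Z := fun e => hno Y hY.1 (e ▸ hZ.1) hY.2
  have mX := (ico_mem_T D ℒ).1 hX.1
  have mX' := (ico_mem_T D ℒ).1 hX.2
  have mY := (ico_mem_T D ℒ).1 hY.1
  have mY' := (ico_mem_T D ℒ).1 hY.2
  have mZ := (ico_mem_T D ℒ).1 hZ.1
  have mZ' := (ico_mem_T D ℒ).1 hZ.2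
  have haZ : D.pos a ∉ Z := fun h =>
    hno Z ((ico_mem_T D ℒ).2 ⟨mZ.1, h, b, hab.symm, mZ.2.1⟩) hZ.1 hZ.2
  have hcX : D.pos c ∉ X := fun h =>
    hno X hX.1 hX.2 ((ico_mem_T D ℒ).2 ⟨mX.1, h, b, hbc, mX'.2.1⟩)
  have nab : D.pos a ≠ D.pos b := fun e => hab (D.inj e)
  have nbc : D.pos b ≠ D.pos c := fun e => hbc (D.inj e)
  have ind1 := ico_indep Z mZ.2.1 mZ'.2.1 haZ nbc
  have ind2 := ico_indep Z mZ'.2.1 mZ.2.1 haZ nbc.symm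
  have ind3 := ico_indep X mX'.2.1 mX.2.1 hcX nab.symm
  let S : Finset (Fin 12) := ((Finset.univ.erase a).erase b).erase c
  have hS : S.card = 9 := by
    have h1 : b ∈ Finset.univ.erase a := by simp [hab.symm]
    have h2 : c ∈ (Finset.univ.erase a).erase b := by simp [hac.symm, hbc.symm]
    rw [Finset.card_erase_of_mem h2, Finset.card_erase_of_mem h1,
      Finset.card_erase_of_mem (Finset.mem_univ a)]
    simp
  have hSm : ∀ v ∈ S, v ≠ a ∧ v ≠ b ∧ v ≠ c := by
    intro v hv
    simp only [S, Finset.mem_erase, Finset.mem_univ, and_true] at hv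
    exact ⟨hv.2.2, hv.2.1, hv.1⟩
  choose u s t hu hs ht hsum hpos using hhull
  have offX : ∀ v ∈ S, D.pos v ∉ X := fun v hv =>
    ico_off_side D ℒ hcov (hSm v hv).1 (hSm v hv).2.1 (hSm v hv).2.2 hU X hX.1 hX.2
  have offY : ∀ v ∈ S, D.pos v ∉ Y := fun v hv =>
    ico_off_side D ℒ hcov (a := a) (b := c) (c := b) (hSm v hv).1 (hSm v hv).2.2 (hSm v hv).2.1
      (fun L hL => by have := hU L hL; tauto) Y hY.1 hY.2
  have offZ : ∀ v ∈ S, D.pos v ∉ Z := fun v hv =>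
    ico_off_side D ℒ hcov (a := b) (b := c) (c := a) (hSm v hv).2.1 (hSm v hv).2.2 (hSm v hv).1
      (fun L hL => by have := hU L hL; tauto) Z hZ.1 hZ.2
  have pt : ∀ v ∈ S, 0 < t v := by
    intro v hv
    refine lt_of_le_of_ne (ht v) fun e => offX v hv ?_
    apply ico_mem_of_param X mX.2.1 mX'.2.1 (s v)
    have : u v = 1 - s v := by linarith [hsum v]
    rw [hpos v, this, ← e]; module
  have ps : ∀ v ∈ S, 0 < s v := by
    intro v hv
    refine lt_of_le_of_ne (hs v) fun e => offY v hv ?_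
    apply ico_mem_of_param Y mY.2.1 mY'.2.1 (t v)
    have : u v = 1 - t v := by linarith [hsum v]
    rw [hpos v, this, ← e]; module
  have pu : ∀ v ∈ S, 0 < u v := by
    intro v hv
    refine lt_of_le_of_ne (hu v) fun e => offZ v hv ?_
    apply ico_mem_of_param Z mZ.2.1 mZ'.2.1 (t v)
    have : s v = 1 - t v := by linarith [hsum v]
    rw [hpos v, this, ← e]; module
  have ne : ∀ v w, v ≠ w → D.pos w ≠ D.pos v := fun v w h e => h (D.inj e).symm
  refine ico_grid S hS.ge (fun v => s v / u v) (fun v => t v / u v) (fun v => s v / t v)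
    (fun v hv => div_pos (ps v hv) (pu v hv)) (fun v hv => div_pos (pt v hv) (pu v hv))
    ?_ ?_ ?_ ?_ ?_
  · intro v hv
    have := pu v hv
    have := pt v hv
    field_simp
  · intro v hv w hw e1 e2
    have hv0 := pu v hv
    have hw0 := pu w hw
    have f1 : 1 / u v = 1 + s v / u v + t v / u v := by
      field_simp; linarith [hsum v]
    have f2 : 1 / u w = 1 + s w / u w + t w / u w := by
      field_simp; linarith [hsum w]
    have f3 : u v = u w := by
      rw [e1, e2, ← f2] at f1
      field_simp at f1
      linarith
    rw [f3] at e1 e2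
    have f4 : s v = s w := by field_simp at e1; linarith
    have f5 : t v = t w := by field_simp at e2; linarith
    apply D.inj
    rw [hpos v, hpos w, f3, f4, f5]
  · refine ico_corner D ℒ S c (by omega) Y Z hY.2 hZ.2 hYZ _
      (fun v hv => ico_sees D ℒ hcov (a := c) (b := a) (c := b) (hSm v hv).1 (hSm v hv).2.1
        (fun L hL => by have := hU L hL; tauto)) (fun v hv => ⟨offY v hv, offZ v hv⟩) ?_
    intro v hv w hw L hL hvL hwL
    have hL' := (ico_mem_T D ℒ).1 hL
    exact ico_ratio L (hcov.1 L hL'.1) ind1 hL'.2.1 hvL hwL (ne _ _ (hSm v hv).2.2)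
      (hsum v) (hsum w) (pu v hv) (pu w hw) (hpos v) (hpos w)
  · refine ico_corner D ℒ S b (by omega) X Z hX.2 hZ.1 hXZ _
      (fun v hv => ico_sees D ℒ hcov (a := b) (b := a) (c := c) (hSm v hv).1 (hSm v hv).2.2
        (fun L hL => by have := hU L hL; tauto)) (fun v hv => ⟨offX v hv, offZ v hv⟩) ?_
    intro v hv w hw L hL hvL hwL
    have hL' := (ico_mem_T D ℒ).1 hL
    exact ico_ratio L (hcov.1 L hL'.1) ind2 hL'.2.1 hvL hwL (ne _ _ (hSm v hv).2.1)
      (t := s v) (t' := s w) (by linarith [hsum v]) (by linarith [hsum w]) (pu v hv) (pu w hw)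
      (by rw [hpos v]; abel) (by rw [hpos w]; abel)
  · refine ico_corner D ℒ S a (by omega) X Y hX.1 hY.1 hXY _
      (fun v hv => ico_sees D ℒ hcov (a := a) (b := b) (c := c) (hSm v hv).2.1 (hSm v hv).2.2
        hU) (fun v hv => ⟨offX v hv, offY v hv⟩) ?_
    intro v hv w hw L hL hvL hwL
    have hL' := (ico_mem_T D ℒ).1 hL
    exact ico_ratio L (hcov.1 L hL'.1) ind3 hL'.2.1 hvL hwL (ne _ _ (hSm v hv).1)
      (t := u v) (t' := u w) (by linarith [hsum v]) (by linarith [hsum w]) (pt v hv) (pt w hw)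
      (by rw [hpos v]; abel) (by rw [hpos w]; abel)

theorem ico_hull (D : StraightLineDrawing 3 icosahedronGraph) :
    ∃ E : Finset (Fin 12),
      (∀ v ∈ E, D.pos v ∈ Set.extremePoints ℝ (convexHull ℝ (Set.range D.pos))) ∧
      ∀ v, D.pos v ∈ convexHull ℝ (D.pos '' (E : Set (Fin 12))) := by
  classical
  refine ⟨Finset.univ.filter fun v =>
    D.pos v ∈ Set.extremePoints ℝ (convexHull ℝ (Set.range D.pos)), by simp, fun v => ?_⟩
  have h1 := closure_convexHull_extremePoints
    ((Set.finite_range D.pos).isCompact_convexHull (𝕜 := ℝ)) (convex_convexHull ℝ (Set.range D.pos))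
  have h2 : Set.extremePoints ℝ (convexHull ℝ (Set.range D.pos)) = D.pos ''
      ((Finset.univ.filter fun v =>
    D.pos v ∈ Set.extremePoints ℝ (convexHull ℝ (Set.range D.pos)) : Finset (Fin 12)) :
      Set (Fin 12)) := by
    ext x
    constructor
    · intro hx
      obtain ⟨v, rfl⟩ := extremePoints_convexHull_subset hx
      exact ⟨v, by simpa using hx, rfl⟩
    · rintro ⟨v, hv, rfl⟩
      simpa using hv
  rw [← h2]
  have hfin : (Set.extremePoints ℝ (convexHull ℝ (Set.range D.pos))).Finite :=
    (Set.finite_range D.pos).subset extremePoints_convexHull_subset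
  rw [(hfin.isClosed_convexHull (𝕜 := ℝ)).closure_eq] at h1
  rw [h1]
  exact subset_convexHull ℝ _ ⟨v, rfl⟩

/-- Every crossing-free straight-line drawing of the icosahedron graph in `ℝ³` covered by
a family `ℒ` of lines satisfies `|ℒ| ≥ 13`. -/
theorem icosahedron_line_cover_lower_bound
    (D : StraightLineDrawing 3 icosahedronGraph)
    (ℒ : Finset (AffineSubspace ℝ (EuclideanSpace ℝ (Fin 3))))
    (hcov : D.CoveredByLines ℒ) :
    13 ≤ ℒ.card := by
  classical
  by_contra hlt
  obtain ⟨E, hE, hhull⟩ := ico_hull D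
  have h5 : ∀ v ∈ E, 5 ≤ (icoT D ℒ v).card := fun v hv => ico_T_extreme D ℒ hcov v (hE v hv)
  have hTL : ∀ v, icoT D ℒ v ⊆ ℒ := fun v L hL => ((ico_mem_T D ℒ).1 hL).1
  rcases lt_trichotomy E.card 3 with h | h | h
  · -- all points are collinear
    obtain ⟨F, hEF, hF⟩ := Finset.exists_superset_card_eq (s := E) (n := 2) (by omega) (by simp)
    obtain ⟨a, b, hab, rfl⟩ := Finset.card_eq_two.1 hF
    have nab : D.pos a ≠ D.pos b := fun e => hab (D.inj e)
    have hdir : Module.finrank ℝ (line[ℝ, D.pos a, D.pos b]).direction = 1 := by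
      rw [direction_affineSpan, vectorSpan_pair, finrank_span_singleton]
      simpa [sub_eq_zero] using nab
    have hline : ∀ v, D.pos v ∈ line[ℝ, D.pos a, D.pos b] := by
      intro v
      have h1 : D.pos v ∈ convexHull ℝ ({D.pos a, D.pos b} : Set _) := by
        refine convexHull_mono ?_ (hhull v)
        rintro _ ⟨x, hx, rfl⟩
        have := hEF hx
        simp only [Finset.mem_insert, Finset.mem_singleton] at this
        rcases this with rfl | rfl <;> simp
      exact convexHull_subset_affineSpan _ h1
    have h3 := ico_T_ge_three D ℒ hcov 0
    obtain ⟨L, hL, M, hM, hLM⟩ := Finset.one_lt_card.1 (show 1 < (icoT D ℒ 0).card by omega)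
    have key : ∀ L ∈ icoT D ℒ 0, L = line[ℝ, D.pos a, D.pos b] := by
      intro L hL
      obtain ⟨h1, h2, x, hx, hxL⟩ := (ico_mem_T D ℒ).1 hL
      exact ico_line_unique L _ (hcov.1 L h1) hdir (fun e => hx (D.inj e).symm) h2 hxL
        (hline 0) (hline x)
    exact hLM ((key L hL).trans (key M hM).symm)
  · obtain ⟨a, b, c, hab, hac, hbc, rfl⟩ := Finset.card_eq_three.1 h
    refine ico_triangle D ℒ hcov (by omega) hab hac hbc (h5 a (by simp)) (h5 b (by simp))
      (h5 c (by simp)) fun v => ?_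
    have hv := hhull v
    simp only [Finset.coe_insert, Finset.coe_singleton, Set.image_insert_eq,
      Set.image_singleton] at hv
    rw [convexHull_insert (by simp), convexHull_pair, mem_convexJoin] at hv
    obtain ⟨x, hx, y, ⟨k, l, hk, hl, hkl, rfl⟩, ⟨m, n, hm, hn, hmn, e⟩⟩ := hv
    rw [Set.mem_singleton_iff] at hx
    subst hx
    refine ⟨m, n * k, n * l, hm, by positivity, by positivity, ?_, ?_⟩
    · rw [add_assoc, ← mul_add, hkl, mul_one, hmn]
    · rw [← e]; module
  · -- four extreme points
    obtain ⟨F, hFE, hF⟩ := Finset.exists_subset_card_eq (show 4 ≤ E.card by omega)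
    obtain ⟨a, b, c, d, hab, hac, had, hbc, hbd, hcd, rfl⟩ := Finset.card_eq_four.1 hF
    have qa := h5 a (hFE (by simp))
    have qb := h5 b (hFE (by simp))
    have qc := h5 c (hFE (by simp))
    have qd := h5 d (hFE (by simp))
    have iab := ico_T_inter_card D ℒ hcov hab
    have iac := ico_T_inter_card D ℒ hcov hac
    have iad := ico_T_inter_card D ℒ hcov had
    have ibc := ico_T_inter_card D ℒ hcov hbc
    have ibd := ico_T_inter_card D ℒ hcov hbd
    have icd := ico_T_inter_card D ℒ hcov hcd
    have k1 := Finset.card_union_add_card_inter (icoT D ℒ a) (icoT D ℒ b)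
    have k2 := Finset.card_union_add_card_inter (icoT D ℒ a ∪ icoT D ℒ b) (icoT D ℒ c)
    have k3 := Finset.card_union_add_card_inter (icoT D ℒ a ∪ icoT D ℒ b ∪ icoT D ℒ c)
      (icoT D ℒ d)
    rw [Finset.union_inter_distrib_right] at k2
    rw [Finset.union_inter_distrib_right, Finset.union_inter_distrib_right] at k3
    have j1 := Finset.card_union_le (icoT D ℒ a ∩ icoT D ℒ c) (icoT D ℒ b ∩ icoT D ℒ c)
    have j2 := Finset.card_union_le (icoT D ℒ a ∩ icoT D ℒ d) (icoT D ℒ b ∩ icoT D ℒ d)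
    have j3 := Finset.card_union_le (icoT D ℒ a ∩ icoT D ℒ d ∪ icoT D ℒ b ∩ icoT D ℒ d)
      (icoT D ℒ c ∩ icoT D ℒ d)
    have hle := Finset.card_le_card (Finset.union_subset (Finset.union_subset
      (Finset.union_subset (hTL a) (hTL b)) (hTL c)) (hTL d))
    omega
end
end
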